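/- arXiv:1111.6657 — 2 statements merged into one kernel-verified Lean document; each statement's English description precedes it below -/
import Mathlib

section
/- Let g be even, Γ the bounded part of the tropical hyperelliptic curve of genus g, and D* = (g/2)(V_0 + V_0′). The tropical module 𝓜_g = { max( max_{0≤i≤3g/2}(a_{3g/2−i} + iX), max_{0≤i≤g/2−1}(b_i + iX + Y) ) : a_i, b_i ∈ ℝ ∪ {−∞} }, viewed as rational functions on Γ via the coordinates (X,Y), is a proper subset of R(3D*): every element of 𝓜_g lies in R(3D*), but there exists a rational function in R(3D*) not belonging to 𝓜_g. -/
open scoped BigOperators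

namespace TropicalHyperelliptic

/-! ## The tropical hyperelliptic curve

For a genus `g ≥ 1` and parameters `c₋₁, c₀, …, c_{g+1}` (encoded as a function
`c : ℤ → ℝ`; only the values `c (-1), …, c (g+1)` matter), the tropical
polynomial `F̃(X,Y) = max(2Y, Y + P̃(X), c₋₁)` with
`P̃(X) = max_{0 ≤ i ≤ g+1} (c_i + iX)` defines the tropical hyperelliptic curve
`Γ̄` as the locus of points of `ℝ²` where `F̃` fails to be differentiable. -/

/-- The tropical polynomial `P̃(X) = max_{0 ≤ i ≤ g+1} (c_i + i X)`. -/
noncomputable def Ptilde (g : ℕ) (c : ℤ → ℝ) (X : ℝ) : ℝ :=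
  (Finset.range (g + 2)).sup' (Finset.nonempty_range_iff.mpr (by omega))
    fun i => c (i : ℤ) + (i : ℝ) * X

/-- The tropical polynomial `F̃(X,Y) = max(2Y, Y + P̃(X), c₋₁)`. -/
noncomputable def Ftilde (g : ℕ) (c : ℤ → ℝ) (P : ℝ × ℝ) : ℝ :=
  max (2 * P.2) (max (P.2 + Ptilde g c P.1) (c (-1)))

/-- The tropical hyperelliptic curve `Γ̄` of genus `g`: the set of points of
`ℝ²` at which `F̃` is not differentiable. -/
def curveBar (g : ℕ) (c : ℤ → ℝ) : Set (ℝ × ℝ) :=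
  {P | ¬ DifferentiableAt ℝ (Ftilde g c) P}

/-- The hypotheses on the parameters: `c_{g+1} = c_g = 0`, `c₋₁ < 2c₀`,
`cᵢ + c_{i+2} < 2c_{i+1}` for `0 ≤ i ≤ g − 2`, and `c_{g−1} < 2c_g = 0`.
Under these assumptions `Γ̄` is a smooth tropical curve of genus `g`. -/
def Hyp (g : ℕ) (c : ℤ → ℝ) : Prop :=
  c ((g : ℤ) + 1) = 0 ∧ c (g : ℤ) = 0 ∧ c (-1) < 2 * c 0 ∧
  (∀ i : ℕ, (i : ℤ) ≤ (g : ℤ) - 2 → c i + c ((i : ℤ) + 2) < 2 * c ((i : ℤ) + 1)) ∧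
  c ((g : ℤ) - 1) < 0

/-- The vertices `V_i` (`0 ≤ i ≤ g`) of `Γ̄` lying above the line
`Y = c₋₁/2`:  `V_0 = (0,0)` and
`V_i = (c_{g−i} − c_{g−i+1}, (g−i+1)c_{g−i} − (g−i)c_{g−i+1})`.
(The formula below also gives `V_0 = (0,0)` for `i = 0`, since
`c_g = c_{g+1} = 0`.) -/
noncomputable def V (g : ℕ) (c : ℤ → ℝ) (i : ℕ) : ℝ × ℝ :=
  (c ((g : ℤ) - i) - c ((g : ℤ) - i + 1),
   (((g : ℤ) - i + 1 : ℤ) : ℝ) * c ((g : ℤ) - i)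
     - (((g : ℤ) - i : ℤ) : ℝ) * c ((g : ℤ) - i + 1))

/-- The conjugate `P′` of a point `P`: the reflection with respect to the line
`Y = c₋₁/2`. -/
def conj (c : ℤ → ℝ) (P : ℝ × ℝ) : ℝ × ℝ := (P.1, c (-1) - P.2)

/-- The metric graph `Γ` obtained from `Γ̄` by removing all unbounded edges:
the part of `Γ̄` lying in the vertical strip `x(V_g) ≤ X ≤ x(V_0) = 0`,
where `x(V_g) = c_0 − c_1`. -/
def Gam (g : ℕ) (c : ℤ → ℝ) : Set (ℝ × ℝ) :=
  {P ∈ curveBar g c | c 0 - c 1 ≤ P.1 ∧ P.1 ≤ 0}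

/-! ## Rational functions, orders, and divisors -/

/-- The image in `ℝ²` of an integer vector. -/
def vr (v : ℤ × ℤ) : ℝ × ℝ := ((v.1 : ℝ), (v.2 : ℝ))

/-- The primitive integer directions along which one can leave the point `P`
inside the set `S` (the outgoing directions of the segments of `S` emanating
from `P`). -/
def localDirs (S : Set (ℝ × ℝ)) (P : ℝ × ℝ) : Set (ℤ × ℤ) :=
  {v | IsCoprime v.1 v.2 ∧ ∃ ε > (0 : ℝ), ∀ t : ℝ, 0 < t → t < ε → P + t • vr v ∈ S}

/-- `f` has (integer) outgoing slope `s` at `P` in the direction `v` (slopes are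
measured with respect to the lattice length). -/
def HasSlope (S : Set (ℝ × ℝ)) (f : ℝ × ℝ → ℝ) (P : ℝ × ℝ) (v : ℤ × ℤ) (s : ℤ) : Prop :=
  ∃ ε > (0 : ℝ), ∀ t : ℝ, 0 ≤ t → t < ε → P + t • vr v ∈ S →
    f (P + t • vr v) = f P + (s : ℝ) * t

/-- A rational function on (the tropical curve) `S ⊆ ℝ²`: a continuous function
whose restriction to every edge is piecewise linear with integer slopes,
i.e. which has an integer outgoing slope at every point of `S` in every
outgoing direction. -/
structure IsRationalFn (S : Set (ℝ × ℝ)) (f : ℝ × ℝ → ℝ) : Prop where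
  cont : ContinuousOn f S
  slope_int : ∀ P ∈ S, ∀ v ∈ localDirs S P, ∃ s : ℤ, HasSlope S f P v s

/-- The outgoing slope of `f` at `P` in the direction `v` (defaulting to `0`
when no integer slope exists). -/
noncomputable def slope (S : Set (ℝ × ℝ)) (f : ℝ × ℝ → ℝ) (P : ℝ × ℝ) (v : ℤ × ℤ) : ℤ :=
  open scoped Classical in
  if h : ∃ s : ℤ, HasSlope S f P v s then h.choose else 0

/-- The order `ord_P f`: the sum of the outgoing slopes of `f` over all segments
of `S` emanating from `P`.  Points with `ord_P f > 0` are the zeros of `f`,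
points with `ord_P f < 0` its poles. -/
noncomputable def ord (S : Set (ℝ × ℝ)) (f : ℝ × ℝ → ℝ) (P : ℝ × ℝ) : ℤ :=
  ∑ᶠ v ∈ localDirs S P, slope S f P v

/-- Divisors: formal `ℤ`-linear combinations of finitely many points of `ℝ²`. -/
abbrev Div := (ℝ × ℝ) →₀ ℤ

/-- The degree of a divisor: the sum of its coefficients. -/
def deg (D : Div) : ℤ := D.sum fun _ n => n

/-- A divisor is effective (`D > 0`) when all its coefficients are nonnegative. -/
def Eff (D : Div) : Prop := ∀ P, 0 ≤ D P

/-- `R(D)`: the set of rational functions `f` on `S` with `(f) + D` effective. -/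
def RSet (S : Set (ℝ × ℝ)) (D : Div) : Set ((ℝ × ℝ) → ℝ) :=
  {f | IsRationalFn S f ∧ ∀ P ∈ S, 0 ≤ ord S f P + D P}

/-- A divisor is principal when it is the divisor `(f) = Σ_P (ord_P f)·P` of a
rational function `f` on `S`. -/
def IsPrincipal (S : Set (ℝ × ℝ)) (D : Div) : Prop :=
  ∃ f : (ℝ × ℝ) → ℝ, IsRationalFn S f ∧ ∀ P, D P = ord S f P

/-- Two divisors are (linearly) equivalent, `D ∼ D′`, when `D′ = D + (f)` for
some rational function `f` on `S`. -/
def LinEquiv (S : Set (ℝ × ℝ)) (D D' : Div) : Prop :=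
  ∃ f : (ℝ × ℝ) → ℝ, IsRationalFn S f ∧ ∀ P, D' P = D P + ord S f P

end TropicalHyperelliptic

/-! ## The cycles `α_i` and the set `𝔇̃_g^+(Γ)` -/

namespace TropicalHyperelliptic

/-- The basis cycle `α_i` (`1 ≤ i ≤ g`) of the fundamental group `π₁(Γ)`:
the cycle of `Γ` through the vertices `V_{i−1}`, `V_i` and their conjugates
`V_{i−1}′`, `V_i′`, i.e. the part of `Γ` in the vertical strip
`x(V_i) ≤ X ≤ x(V_{i−1})`. -/
def alphaCycle (g : ℕ) (c : ℤ → ℝ) (i : ℕ) : Set (ℝ × ℝ) :=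
  {P ∈ Gam g c | (V g c i).1 ≤ P.1 ∧ P.1 ≤ (V g c (i - 1)).1}

/-- The overlap `α_{k,k+1} = (α_k ∩ α_{k+1}) ∖ {endpoints}` (`1 ≤ k ≤ g − 1`):
the open vertical edge of `Γ` joining `V_k` to `V_k′`.  (For non-adjacent
indices the overlaps `α_i ∩ α_j` are empty.) -/
def alphaOpen (g : ℕ) (c : ℤ → ℝ) (k : ℕ) : Set (ℝ × ℝ) :=
  {P ∈ Gam g c | P.1 = (V g c k).1 ∧ P ≠ V g c k ∧ P ≠ conj c (V g c k)}

/-- The subset `𝔇̃_g^+(Γ)` of `𝔇_g^+(Γ)`: effective divisors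
`P_1 + ⋯ + P_g` with `P_i ∈ α_i` for all `i`, such that each overlap `α_{ij}`
contains at most one of the points. -/
def Dtilde (g : ℕ) (c : ℤ → ℝ) : Set Div :=
  {D | ∃ Pt : Fin g → ℝ × ℝ,
    (∀ i : Fin g, Pt i ∈ alphaCycle g c (i + 1)) ∧
    (∀ k : ℕ, 1 ≤ k → k ≤ g - 1 →
      ∀ i j : Fin g, Pt i ∈ alphaOpen g c k → Pt j ∈ alphaOpen g c k → i = j) ∧
    D = ∑ i : Fin g, Finsupp.single (Pt i) (1 : ℤ)}

/-- For even `g`, the base divisor `D* = (g/2)(V_0 + V_0′)`. -/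
noncomputable def DstarEven (g : ℕ) (c : ℤ → ℝ) : Div :=
  ((g / 2 : ℕ) : ℤ) •
    (Finsupp.single (V g c 0) (1 : ℤ) + Finsupp.single (conj c (V g c 0)) (1 : ℤ))

/-- For odd `g`, the base divisor `D* = ((g−1)/2)(V_0 + V_0′) + V_0`. -/
noncomputable def DstarOdd (g : ℕ) (c : ℤ → ℝ) : Div :=
  (((g - 1) / 2 : ℕ) : ℤ) •
    (Finsupp.single (V g c 0) (1 : ℤ) + Finsupp.single (conj c (V g c 0)) (1 : ℤ))
  + Finsupp.single (V g c 0) (1 : ℤ)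

end TropicalHyperelliptic

namespace TropicalHyperelliptic

/-- For even `g`, the tropical module `𝓜_g` spanned by the rational functions
`x^{⊗i}` (`0 ≤ i ≤ 3g/2`) and `x^{⊗i} ⊗ y` (`0 ≤ i ≤ g/2 − 1`): a function on
`Γ` belongs to `𝓜_g` when it agrees on `Γ` with
`max( max_{0≤i≤3g/2}(a_i + iX), max_{0≤i≤g/2−1}(b_i + iX + Y) )`
for some coefficients `a_i, b_i ∈ 𝕋 = ℝ ∪ {−∞}`. -/
def InMgEven (g : ℕ) (c : ℤ → ℝ) (f : (ℝ × ℝ) → ℝ) : Prop :=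
  ∃ a b : ℕ → EReal, ∀ P ∈ Gam g c,
    (f P : EReal) =
      max ((Finset.range (3 * g / 2 + 1)).sup
            fun i => a i + (((i : ℝ) * P.1 : ℝ) : EReal))
          ((Finset.range (g / 2)).sup
            fun i => b i + (((i : ℝ) * P.1 + P.2 : ℝ) : EReal))

end TropicalHyperelliptic

open TropicalHyperelliptic

namespace TropicalHyperelliptic

open Filter Topology

lemma localmax {ι : Type*} (s : Finset ι) (A B : ι → ℝ) (M : ℝ)
    (h1 : ∀ j ∈ s, A j ≤ M) (h2 : ∃ j ∈ s, A j = M) :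
    ∃ i ∈ s, A i = M ∧ (∀ j ∈ s, A j = M → B j ≤ B i) ∧
      ∃ ε > (0 : ℝ), ∀ t : ℝ, 0 ≤ t → t < ε → ∀ j ∈ s, A j + B j * t ≤ A i + B i * t := by
  classical
  obtain ⟨j0, hj0, hj0M⟩ := h2
  obtain ⟨i, hi, himax⟩ := Finset.exists_max_image (s.filter fun j => A j = M) B
    ⟨j0, Finset.mem_filter.2 ⟨hj0, hj0M⟩⟩
  rw [Finset.mem_filter] at hi
  have hB : ∀ j ∈ s, A j = M → B j ≤ B i := fun j hj hjM =>
    himax j (Finset.mem_filter.2 ⟨hj, hjM⟩)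
  refine ⟨i, hi.1, hi.2, hB, ?_⟩
  have key : ∀ᶠ t in 𝓝[≥] (0 : ℝ), ∀ j ∈ s, A j + B j * t ≤ A i + B i * t := by
    rw [Filter.eventually_all_finset]
    intro j hj
    rcases (h1 j hj).lt_or_eq with h | h
    · have hc1 : ContinuousAt (fun t : ℝ => A j + B j * t) 0 := by fun_prop
      have hc2 : ContinuousAt (fun t : ℝ => A i + B i * t) 0 := by fun_prop
      have : ∀ᶠ t in 𝓝 (0 : ℝ), A j + B j * t < A i + B i * t :=
        hc1.eventually_lt hc2 (by simp [hi.2, h])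
      exact (this.filter_mono nhdsWithin_le_nhds).mono fun t ht => ht.le
    · filter_upwards [self_mem_nhdsWithin] with t ht
      have := mul_le_mul_of_nonneg_right (hB j hj h) (Set.mem_Ici.1 ht)
      linarith [hi.2]
  rw [eventually_nhdsWithin_iff, Metric.eventually_nhds_iff] at key
  obtain ⟨ε, hε, hk⟩ := key
  refine ⟨ε, hε, fun t ht0 ht => hk ?_ ht0⟩
  rwa [Real.dist_eq, sub_zero, abs_of_nonneg ht0]

lemma not_diff_of_kink (h : ℝ → ℝ) (x p q ε : ℝ) (hε : 0 < ε) (hpq : p ≠ q)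
    (hp : ∀ t, 0 ≤ t → t < ε → h (x + t) = h x + p * t)
    (hq : ∀ t, 0 ≤ t → t < ε → h (x - t) = h x - q * t) : ¬ DifferentiableAt ℝ h x := by
  intro hd
  have h1 : HasDerivWithinAt h p (Set.Ici x) x := by
    have : HasDerivWithinAt (fun y => h x + p * (y - x)) p (Set.Ici x) x := by
      have := (((hasDerivAt_id x).sub_const x).const_mul p).const_add (h x)
      simpa using this.hasDerivWithinAt
    refine this.congr_of_eventuallyEq ?_ (by simp)
    have hn : ∀ᶠ y in 𝓝 x, y < x + ε := eventually_lt_nhds (by linarith)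
    filter_upwards [self_mem_nhdsWithin, hn.filter_mono nhdsWithin_le_nhds] with y hy hy2
    have := hp (y - x) (by simpa using hy) (by linarith)
    simpa using this
  have h2 : HasDerivWithinAt h q (Set.Iic x) x := by
    have : HasDerivWithinAt (fun y => h x + q * (y - x)) q (Set.Iic x) x := by
      have := (((hasDerivAt_id x).sub_const x).const_mul q).const_add (h x)
      simpa using this.hasDerivWithinAt
    refine this.congr_of_eventuallyEq ?_ (by simp)
    have hn : ∀ᶠ y in 𝓝 x, x - ε < y := eventually_gt_nhds (by linarith)
    filter_upwards [self_mem_nhdsWithin, hn.filter_mono nhdsWithin_le_nhds] with y hy hy2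
    have := hq (x - y) (by simpa using hy) (by linarith)
    rw [show x - (x - y) = y by ring] at this
    rw [this]; ring
  have e1 := (uniqueDiffWithinAt_Ici x).eq_deriv _ h1 hd.hasDerivAt.hasDerivWithinAt
  have e2 := (uniqueDiffWithinAt_Iic x).eq_deriv _ h2 hd.hasDerivAt.hasDerivWithinAt
  exact hpq (e1.trans e2.symm)

lemma diff_of_affine (h : ℝ → ℝ) (x y p q a b : ℝ) (hxy : a < x) (hyb : x < b)
    (hp : ∀ z, a < z → z < b → h z = p + q * (z - y)) : DifferentiableAt ℝ h x := by
  have : DifferentiableAt ℝ (fun z => p + q * (z - y)) x := by fun_prop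
  refine this.congr_of_eventuallyEq ?_
  filter_upwards [eventually_gt_nhds hxy, eventually_lt_nhds hyb] with z h1 h2
  exact hp z h1 h2

section
variable {g : ℕ} {c : ℤ → ℝ}

lemma d_step (hc : Hyp g c) (hg2 : 2 ≤ g) (i : ℕ) (hi : i + 1 ≤ g) :
    c i - c ((i : ℤ) + 1) < c ((i + 1 : ℕ) : ℤ) - c (((i + 1 : ℕ) : ℤ) + 1) := by
  obtain ⟨h1, h2, h3, h4, h5⟩ := hc
  push_cast
  rw [show (i : ℤ) + 1 + 1 = i + 2 by ring]
  rcases hi.lt_or_eq with h | h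
  · have := h4 i (by omega)
    linarith
  · have e : (i : ℤ) = (g : ℤ) - 1 := by omega
    have e1 : (i : ℤ) + 1 = g := by omega
    have e2 : (i : ℤ) + 2 = (g : ℤ) + 1 := by omega
    rw [e1, e2, e, h1, h2]
    linarith

lemma d_mono (hc : Hyp g c) (hg2 : 2 ≤ g) (i j : ℕ) (hij : i < j) (hj : j ≤ g) :
    c i - c ((i : ℤ) + 1) < c j - c ((j : ℤ) + 1) := by
  induction j, hij using Nat.le_induction with
  | base => exact d_step hc hg2 i hj
  | succ k hk ih => exact (ih (by omega)).trans (d_step hc hg2 k hj)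

lemma P_ge (X : ℝ) (i : ℕ) (hi : i ≤ g + 1) : c i + i * X ≤ Ptilde g c X :=
  Finset.le_sup' (fun i : ℕ => c (i : ℤ) + (i : ℝ) * X) (Finset.mem_range.2 (by omega))

lemma P_ex (X : ℝ) : ∃ i : ℕ, i ≤ g + 1 ∧ c i + i * X = Ptilde g c X := by
  obtain ⟨i, hi, h⟩ := Finset.exists_mem_eq_sup' (s := Finset.range (g + 2))
    (Finset.nonempty_range_iff.mpr (by omega)) (fun i : ℕ => c (i : ℤ) + (i : ℝ) * X)
  exact ⟨i, by have := Finset.mem_range.1 hi; omega, h.symm⟩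

lemma P_pos (hc : Hyp g c) (X : ℝ) : c (-1) < 2 * Ptilde g c X := by
  have := P_ge (g := g) (c := c) X 0 (by omega)
  have h := hc.2.2.1
  simp at this
  linarith

lemma P_cont : Continuous (Ptilde g c) := by
  unfold Ptilde
  exact Continuous.finset_sup'_apply _ (fun i _ => by fun_prop)

/-- Local structure of `P̃`. -/
lemma P_loc (hc : Hyp g c) (hg2 : 2 ≤ g) (X : ℝ) :
    ∃ l r : ℤ, ∃ ε > (0 : ℝ),
      (∀ t, 0 ≤ t → t < ε → Ptilde g c (X + t) = Ptilde g c X + r * t) ∧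
      (∀ t, 0 ≤ t → t < ε → Ptilde g c (X - t) = Ptilde g c X - l * t) ∧
      (r = l ∨ r = l + 1) ∧ (X = 0 → l = g ∧ r = g + 1) ∧
      (X = c 0 - c 1 → l = 0 ∧ r = 1) := by
  have hA1 : ∀ j ∈ Finset.range (g + 2), c (j : ℤ) + (j : ℝ) * X ≤ Ptilde g c X :=
    fun j hj => P_ge X j (by have := Finset.mem_range.1 hj; omega)
  have hA2 : ∃ j ∈ Finset.range (g + 2), c (j : ℤ) + (j : ℝ) * X = Ptilde g c X := by
    obtain ⟨i, hi, h⟩ := P_ex (g := g) (c := c) X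
    exact ⟨i, Finset.mem_range.2 (by omega), h⟩
  obtain ⟨r, hr, hrM, hrmax, e1, he1, hr1⟩ := localmax (Finset.range (g + 2))
    (fun j : ℕ => c (j : ℤ) + (j : ℝ) * X) (fun j => (j : ℝ)) _ hA1 hA2
  obtain ⟨l, hl, hlM, hlmax, e2, he2, hl1⟩ := localmax (Finset.range (g + 2))
    (fun j : ℕ => c (j : ℤ) + (j : ℝ) * X) (fun j => -(j : ℝ)) _ hA1 hA2
  have hr' := Finset.mem_range.1 hr
  have hl' := Finset.mem_range.1 hl
  have hlr : l ≤ r := by exact_mod_cast hrmax l hl hlM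
  have hrR : r ≤ g → X < c r - c ((r : ℤ) + 1) := by
    intro h
    have a1 := P_ge (g := g) (c := c) X (r + 1) (by omega)
    by_contra hcon
    have a2 : c ((r + 1 : ℕ) : ℤ) + ((r + 1 : ℕ) : ℝ) * X = Ptilde g c X := by
      apply le_antisymm a1
      rw [← hrM]; push_cast; linarith
    have := hrmax (r + 1) (Finset.mem_range.2 (by omega)) a2
    push_cast at this; linarith
  have hlL : ∀ k : ℕ, l = k + 1 → c k - c ((k : ℤ) + 1) < X := by
    intro k hk
    have a1 := P_ge (g := g) (c := c) X k (by omega)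
    by_contra hcon
    have hlM' := hlM
    rw [hk] at hlM'
    push_cast at hlM'
    have a2 : c ((k : ℕ) : ℤ) + ((k : ℕ) : ℝ) * X = Ptilde g c X := by
      apply le_antisymm a1
      linarith
    have := hlmax k (Finset.mem_range.2 (by omega)) a2
    rw [hk] at this
    push_cast at this; linarith
  have hlR : l ≤ g → X ≤ c l - c ((l : ℤ) + 1) := by
    intro h
    have a1 := P_ge (g := g) (c := c) X (l + 1) (by omega)
    push_cast at a1; linarith
  have hrL : ∀ k : ℕ, r = k + 1 → c k - c ((k : ℤ) + 1) ≤ X := by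
    intro k hk
    have a1 := P_ge (g := g) (c := c) X k (by omega)
    rw [hk] at hrM
    push_cast at hrM; linarith
  refine ⟨l, r, min e1 e2, lt_min he1 he2, ?_, ?_, ?_, ?_, ?_⟩
  · intro t ht0 ht
    have h := hr1 t ht0 (ht.trans_le (min_le_left _ _))
    push_cast
    rw [← hrM]
    obtain ⟨i, hi, hiM⟩ := P_ex (g := g) (c := c) (X + t)
    apply le_antisymm
    · have := h i (Finset.mem_range.2 (by omega))
      rw [← hiM]; linarith
    · have := P_ge (g := g) (c := c) (X + t) r (by omega)
      linarith
  · intro t ht0 ht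
    have h := hl1 t ht0 (ht.trans_le (min_le_right _ _))
    push_cast
    rw [← hlM]
    obtain ⟨i, hi, hiM⟩ := P_ex (g := g) (c := c) (X - t)
    apply le_antisymm
    · have := h i (Finset.mem_range.2 (by omega))
      rw [← hiM]; linarith
    · have := P_ge (g := g) (c := c) (X - t) l (by omega)
      linarith
  · by_contra hcon
    obtain ⟨k, hk⟩ : ∃ k, r = k + 1 := ⟨r - 1, by omega⟩
    have h1 := hrL k hk
    have h2 := hlR (by omega)
    have h3 := d_mono hc hg2 l k (by omega) (by omega)
    linarith
  · intro hX
    have hd : c (g : ℤ) - c ((g : ℤ) + 1) = 0 := by rw [hc.1, hc.2.1]; ring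
    have hrg : r = g + 1 := by
      by_contra hcon
      have h1 := hrR (by omega)
      rcases (show r ≤ g by omega).lt_or_eq with h | h
      · have := d_mono hc hg2 r g h le_rfl
        linarith
      · rw [h] at h1; linarith
    have hlg : l = g := by
      rcases lt_trichotomy l g with h | h | h
      · have h1 := hlR (by omega)
        have := d_mono hc hg2 l g h le_rfl
        linarith
      · exact h
      · have h1 := hlL g (by omega)
        linarith
    exact ⟨by omega, by omega⟩
  · intro hX
    have hl0 : l = 0 := by
      by_contra hcon
      obtain ⟨k, hk⟩ : ∃ k, l = k + 1 := ⟨l - 1, by omega⟩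
      have h1 := hlL k hk
      rcases Nat.eq_zero_or_pos k with h | h
      · subst h; simp at h1; linarith
      · have := d_mono hc hg2 0 k h (by omega)
        simp at this; linarith
    have hr1 : r = 1 := by
      rcases Nat.eq_zero_or_pos r with h | h
      · have h1 := hrR (by omega)
        subst h; simp at h1; linarith
      · obtain ⟨k, hk⟩ : ∃ k, r = k + 1 := ⟨r - 1, by omega⟩
        have h1 := hrL k hk
        rcases Nat.eq_zero_or_pos k with h | h
        · omega
        · have := d_mono hc hg2 0 k h (by omega)
          simp at this; linarith
    exact ⟨by omega, by omega⟩

lemma curve_iff (hc : Hyp g c) (X Y : ℝ) :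
    (X, Y) ∈ curveBar g c ↔ Y = Ptilde g c X ∨ Y = c (-1) - Ptilde g c X ∨
      (c (-1) - Ptilde g c X < Y ∧ Y < Ptilde g c X ∧ ¬ DifferentiableAt ℝ (Ptilde g c) X) := by
  have hP := P_pos hc X
  have hcont : Continuous fun Q : ℝ × ℝ => Ptilde g c Q.1 := P_cont.comp continuous_fst
  unfold curveBar
  rw [Set.mem_ofPred_eq]
  have vert : DifferentiableAt ℝ (Ftilde g c) (X, Y) →
      DifferentiableAt ℝ (fun y => Ftilde g c (X, y)) Y := by
    intro h
    exact DifferentiableAt.comp (f := fun y : ℝ => (X, y)) Y h (by fun_prop)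
  rcases lt_trichotomy Y (Ptilde g c X) with h | h | h
  · rcases lt_trichotomy Y (c (-1) - Ptilde g c X) with h' | h' | h'
    · have hd : DifferentiableAt ℝ (Ftilde g c) (X, Y) := by
        have : DifferentiableAt ℝ (fun _ : ℝ × ℝ => c (-1)) (X, Y) := by fun_prop
        refine this.congr_of_eventuallyEq ?_
        have e1 : ∀ᶠ Q : ℝ × ℝ in 𝓝 (X, Y), Q.2 + Ptilde g c Q.1 < c (-1) :=
          (continuous_snd.add hcont).continuousAt.eventually_lt continuousAt_const (by simp; linarith)
        have e2 : ∀ᶠ Q : ℝ × ℝ in 𝓝 (X, Y), 2 * Q.2 < c (-1) :=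
          (continuous_const.mul continuous_snd).continuousAt.eventually_lt continuousAt_const
            (by simp; linarith)
        filter_upwards [e1, e2] with Q h1 h2
        unfold Ftilde
        rw [max_eq_right h1.le, max_eq_right h2.le]
      constructor
      · intro h; exact absurd hd h
      · rintro (h1 | h1 | h1)
        · linarith
        · linarith
        · linarith [h1.1]
    · refine iff_of_true (fun hd => ?_) (Or.inr (Or.inl h'))
      refine not_diff_of_kink _ Y 1 0 (2 * Ptilde g c X - c (-1)) (by linarith) (by norm_num)
        ?_ ?_ (vert hd)
      · intro t h0 h1
        simp only [Ftilde]
        rw [max_eq_left (b := c (-1)) (by linarith), max_eq_left (b := c (-1)) (by linarith),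
          max_eq_right (by linarith), max_eq_right (by linarith)]
        ring
      · intro t h0 h1
        simp only [Ftilde]
        rw [max_eq_right (a := Y - t + Ptilde g c X) (by linarith),
          max_eq_right (a := Y + Ptilde g c X) (by linarith), max_eq_right (by linarith), max_eq_right (by linarith)]
        ring
    · have e : Ftilde g c =ᶠ[𝓝 (X, Y)] fun Q => Q.2 + Ptilde g c Q.1 := by
        have e1 : ∀ᶠ Q : ℝ × ℝ in 𝓝 (X, Y), c (-1) < Q.2 + Ptilde g c Q.1 :=
          continuousAt_const.eventually_lt (continuous_snd.add hcont).continuousAt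
            (by simp; linarith)
        have e2 : ∀ᶠ Q : ℝ × ℝ in 𝓝 (X, Y), Q.2 < Ptilde g c Q.1 :=
          continuous_snd.continuousAt.eventually_lt hcont.continuousAt (by simpa using h)
        filter_upwards [e1, e2] with Q h1 h2
        unfold Ftilde
        rw [max_eq_left h1.le, max_eq_right (by linarith)]
      have e3 : DifferentiableAt ℝ (Ftilde g c) (X, Y) ↔ DifferentiableAt ℝ (Ptilde g c) X := by
        rw [e.differentiableAt_iff]
        constructor
        · intro hd
          have := DifferentiableAt.comp (f := fun x : ℝ => (x, Y)) X hd (by fun_prop)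
          have h2 : Ptilde g c = fun x => ((fun Q : ℝ × ℝ => Q.2 + Ptilde g c Q.1) ∘
              (fun x : ℝ => (x, Y))) x - Y := by
            ext x; simp
          rw [h2]
          exact this.sub_const Y
        · intro hd
          have : DifferentiableAt ℝ (fun Q : ℝ × ℝ => Ptilde g c Q.1) (X, Y) :=
            DifferentiableAt.comp (f := fun Q : ℝ × ℝ => Q.1) (X, Y) hd (by fun_prop)
          exact differentiableAt_snd.add this
      rw [e3]
      constructor
      · intro hh; exact Or.inr (Or.inr ⟨h', h, hh⟩)
      · rintro (h1 | h1 | h1)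
        · linarith
        · linarith
        · exact h1.2.2
  · refine iff_of_true (fun hd => ?_) (Or.inl h)
    refine not_diff_of_kink _ Y 2 1 (2 * Ptilde g c X - c (-1)) (by linarith) (by norm_num)
      ?_ ?_ (vert hd)
    · intro t h0 h1
      simp only [Ftilde]
      rw [max_eq_left (b := c (-1)) (by linarith), max_eq_left (b := c (-1)) (by linarith),
        max_eq_left (by linarith), max_eq_left (by linarith)]
      ring
    · intro t h0 h1
      simp only [Ftilde]
      rw [max_eq_left (b := c (-1)) (by linarith), max_eq_left (b := c (-1)) (by linarith),
        max_eq_right (by linarith), max_eq_right (by linarith)]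
      linarith
  · have hd : DifferentiableAt ℝ (Ftilde g c) (X, Y) := by
      have : DifferentiableAt ℝ (fun Q : ℝ × ℝ => 2 * Q.2) (X, Y) := by fun_prop
      refine this.congr_of_eventuallyEq ?_
      have e1 : ∀ᶠ Q : ℝ × ℝ in 𝓝 (X, Y), Ptilde g c Q.1 < Q.2 :=
        hcont.continuousAt.eventually_lt continuous_snd.continuousAt (by simpa using h)
      have e2 : ∀ᶠ Q : ℝ × ℝ in 𝓝 (X, Y), c (-1) < 2 * Q.2 :=
        continuousAt_const.eventually_lt (continuous_const.mul continuous_snd).continuousAt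
          (by simp; linarith)
      filter_upwards [e1, e2] with Q h1 h2
      unfold Ftilde
      rw [max_eq_left (max_le (by linarith) h2.le)]
    constructor
    · intro h; exact absurd hd h
    · rintro (h1 | h1 | h1)
      · linarith
      · linarith
      · linarith [h1.2.1]

lemma gam_iff (hc : Hyp g c) (X Y : ℝ) :
    (X, Y) ∈ Gam g c ↔ (Y = Ptilde g c X ∨ Y = c (-1) - Ptilde g c X ∨
      (c (-1) - Ptilde g c X < Y ∧ Y < Ptilde g c X ∧ ¬ DifferentiableAt ℝ (Ptilde g c) X)) ∧
      c 0 - c 1 ≤ X ∧ X ≤ 0 := by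
  rw [← curve_iff hc]; rfl

end

end TropicalHyperelliptic

namespace TropicalHyperelliptic

open Filter Topology

lemma pt_add (X Y t : ℝ) (v : ℤ × ℤ) : ((X, Y) : ℝ × ℝ) + t • vr v = (X + t * v.1, Y + t * v.2) := by
  simp [vr]

lemma mem_localDirs (S : Set (ℝ × ℝ)) (X Y : ℝ) (v : ℤ × ℤ) :
    v ∈ localDirs S (X, Y) ↔ IsCoprime v.1 v.2 ∧
      ∀ᶠ t in 𝓝[>] (0 : ℝ), ((X + t * v.1, Y + t * v.2) : ℝ × ℝ) ∈ S := by
  unfold localDirs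
  rw [Set.mem_ofPred_eq]
  simp only [pt_add]
  refine and_congr_right fun _ => ?_
  change _ ↔ {t : ℝ | ((X + t * v.1, Y + t * v.2) : ℝ × ℝ) ∈ S} ∈ 𝓝[>] (0 : ℝ)
  rw [mem_nhdsGT_iff_exists_Ioo_subset]
  constructor
  · rintro ⟨e, he, h⟩
    exact ⟨e, he, fun t ht => h t ht.1 ht.2⟩
  · rintro ⟨e, he, h⟩
    exact ⟨e, he, fun t h1 h2 => h ⟨h1, h2⟩⟩

lemma coprime_mul {a b r : ℤ} (h : IsCoprime a b) (hb : b = r * a) : a = 1 ∨ a = -1 := by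
  have : IsUnit a := by
    subst hb
    exact h.isUnit_of_dvd' dvd_rfl (Dvd.intro_left r rfl)
  exact Int.isUnit_iff.1 this

section
variable {g : ℕ} {c : ℤ → ℝ}

lemma ev_small (ε k : ℝ) (hε : 0 < ε) : ∀ᶠ t in 𝓝[>] (0 : ℝ), t * k < ε := by
  have : ContinuousAt (fun t : ℝ => t * k) 0 := by fun_prop
  have h := this.eventually_lt (continuousAt_const (y := ε)) (by simpa using hε)
  exact h.filter_mono nhdsWithin_le_nhds

lemma kink_loc (X ε : ℝ) (hε : 0 < ε) (l r : ℤ)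
    (h1 : ∀ t, 0 ≤ t → t < ε → Ptilde g c (X + t) = Ptilde g c X + r * t)
    (h2 : ∀ t, 0 ≤ t → t < ε → Ptilde g c (X - t) = Ptilde g c X - l * t) :
    (∀ t, 0 < t → t < ε → DifferentiableAt ℝ (Ptilde g c) (X + t)) ∧
    (∀ t, 0 < t → t < ε → DifferentiableAt ℝ (Ptilde g c) (X - t)) ∧
    (¬ DifferentiableAt ℝ (Ptilde g c) X ↔ r ≠ l) := by
  refine ⟨?_, ?_, ?_⟩
  · intro t h0 ht
    refine diff_of_affine _ _ X (Ptilde g c X) r X (X + ε) (by linarith) (by linarith) ?_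
    intro z hz1 hz2
    have := h1 (z - X) (by linarith) (by linarith)
    simpa using this
  · intro t h0 ht
    refine diff_of_affine _ _ X (Ptilde g c X) l (X - ε) X (by linarith) (by linarith) ?_
    intro z hz1 hz2
    have := h2 (X - z) (by linarith) (by linarith)
    rw [show X - (X - z) = z by ring] at this
    rw [this]; ring
  · constructor
    · rintro hd rfl
      refine hd (diff_of_affine _ _ X (Ptilde g c X) r (X - ε) (X + ε) (by linarith)
        (by linarith) ?_)
      intro z hz1 hz2
      rcases le_total X z with h | h
      · have := h1 (z - X) (by linarith) (by linarith)
        simpa using this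
      · have := h2 (X - z) (by linarith) (by linarith)
        rw [show X - (X - z) = z by ring] at this
        rw [this]; ring
    · intro hne
      exact not_diff_of_kink _ X r l ε hε (by exact_mod_cast hne) h1 h2

lemma dirs_upper (hc : Hyp g c) (X ε : ℝ) (hX0 : c 0 - c 1 ≤ X) (hX1 : X ≤ 0)
    (hε : 0 < ε) (l r : ℤ)
    (h1 : ∀ t, 0 ≤ t → t < ε → Ptilde g c (X + t) = Ptilde g c X + r * t)
    (h2 : ∀ t, 0 ≤ t → t < ε → Ptilde g c (X - t) = Ptilde g c X - l * t) (v : ℤ × ℤ) :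
    v ∈ localDirs (Gam g c) (X, Ptilde g c X) ↔
      (v = (1, r) ∧ X < 0) ∨ (v = (-1, -l) ∧ c 0 - c 1 < X) ∨ (v = (0, -1) ∧ r ≠ l) := by
  obtain ⟨k1, k2, k3⟩ := kink_loc X ε hε l r h1 h2
  have hP := P_pos hc X
  rw [mem_localDirs]
  simp only [gam_iff hc]
  have hpos : ∀ᶠ t in 𝓝[>] (0 : ℝ), 0 < t := self_mem_nhdsWithin
  constructor
  · rintro ⟨hcop, hev⟩
    have hgap : ∀ᶠ t in 𝓝[>] (0 : ℝ),
        c (-1) - Ptilde g c (X + t * v.1) < Ptilde g c X + t * v.2 := by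
      have ca : Continuous fun t : ℝ => c (-1) - Ptilde g c (X + t * v.1) :=
        continuous_const.sub (P_cont.comp (by fun_prop))
      have cb : Continuous fun t : ℝ => Ptilde g c X + t * v.2 := by fun_prop
      exact (ca.continuousAt.eventually_lt cb.continuousAt (by simp; linarith)).filter_mono
        nhdsWithin_le_nhds
    obtain ⟨t, ht0, htg, ⟨hcase, hr0, hr1⟩, hs1, hs2⟩ :=
      (hpos.and (hgap.and (hev.and ((ev_small ε v.1 hε).and (ev_small ε (-v.1) hε))))).exists
    obtain ⟨a, b⟩ := v
    simp only at *
    rcases lt_trichotomy a 0 with ha | ha | ha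
    · have ha' : (a : ℝ) < 0 := by exact_mod_cast ha
      have hta : t * a < 0 := mul_neg_of_pos_of_neg ht0 ha'
      have hd := k2 (t * -a) (by linarith) hs2
      have hv := h2 (t * -a) (by linarith) hs2
      rw [show X - t * -(a : ℝ) = X + t * a by ring] at hd hv
      rcases hcase with h | h | h
      · have e : (b : ℝ) = l * a := by
          rw [hv] at h
          have : t * (b - l * a : ℝ) = 0 := by linarith
          rcases mul_eq_zero.1 this with h | h <;> linarith
        have e' : b = l * a := by exact_mod_cast e
        rcases coprime_mul hcop e' with h | h
        · omega
        · subst h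
          right; left
          refine ⟨by simp [e'], by linarith⟩
      · linarith
      · exact absurd hd h.2.2
    · subst ha
      have hb : b = 1 ∨ b = -1 := by
        have := isCoprime_zero_left.1 hcop
        exact Int.isUnit_iff.1 this
      simp only [Int.cast_zero, mul_zero, add_zero] at hcase htg
      rcases hb with rfl | rfl
      · exfalso
        push_cast at hcase htg
        rcases hcase with h | h | h
        · linarith
        · linarith
        · linarith [h.2.1]
      · right; right
        push_cast at hcase htg
        rcases hcase with h | h | h
        · linarith
        · linarith
        · exact ⟨rfl, k3.1 h.2.2⟩
    · have ha' : (0 : ℝ) < a := by exact_mod_cast ha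
      have hta : 0 < t * a := mul_pos ht0 ha'
      have hd := k1 (t * a) (by linarith) hs1
      have hv := h1 (t * a) (by linarith) hs1
      rcases hcase with h | h | h
      · have e : (b : ℝ) = r * a := by
          rw [hv] at h
          have : t * (b - r * a : ℝ) = 0 := by linarith
          rcases mul_eq_zero.1 this with h | h <;> linarith
        have e' : b = r * a := by exact_mod_cast e
        rcases coprime_mul hcop e' with h | h
        · subst h
          left
          refine ⟨by simp [e'], by linarith⟩
        · omega
      · linarith
      · exact absurd hd h.2.2
  · rintro (⟨rfl, hx⟩ | ⟨rfl, hx⟩ | ⟨rfl, hk⟩)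
    · refine ⟨isCoprime_one_left, ?_⟩
      filter_upwards [hpos, ev_small ε 1 hε, ev_small (-X) 1 (by linarith)] with t t0 t1 t2
      simp only [Int.cast_one, mul_one] at *
      refine ⟨Or.inl ?_, by linarith, by linarith⟩
      rw [h1 t t0.le t1]; ring
    · refine ⟨by simpa using (isCoprime_one_left (x := -l)).neg_left, ?_⟩
      filter_upwards [hpos, ev_small ε 1 hε, ev_small (X - (c 0 - c 1)) 1 (by linarith)]
        with t t0 t1 t2
      push_cast
      simp only [mul_one] at *
      refine ⟨Or.inl ?_, by linarith, by linarith⟩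
      rw [show X + t * -1 = X - t by ring, h2 t t0.le t1]; ring
    · refine ⟨by simp [isCoprime_zero_left], ?_⟩
      filter_upwards [hpos, ev_small (2 * Ptilde g c X - c (-1)) 1 (by linarith)] with t t0 t1
      push_cast
      simp only [mul_zero, add_zero]
      exact ⟨Or.inr (Or.inr ⟨by linarith, by linarith, k3.2 hk⟩), hX0, hX1⟩

lemma dirs_middle (hc : Hyp g c) (X Y ε : ℝ) (hX0 : c 0 - c 1 ≤ X) (hX1 : X ≤ 0)
    (hY0 : c (-1) - Ptilde g c X < Y) (hY1 : Y < Ptilde g c X)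
    (hε : 0 < ε) (l r : ℤ) (hrl : ¬ DifferentiableAt ℝ (Ptilde g c) X)
    (h1 : ∀ t, 0 ≤ t → t < ε → Ptilde g c (X + t) = Ptilde g c X + r * t)
    (h2 : ∀ t, 0 ≤ t → t < ε → Ptilde g c (X - t) = Ptilde g c X - l * t) (v : ℤ × ℤ) :
    v ∈ localDirs (Gam g c) (X, Y) ↔ v = (0, 1) ∨ v = (0, -1) := by
  obtain ⟨k1, k2, k3⟩ := kink_loc X ε hε l r h1 h2
  rw [mem_localDirs]
  simp only [gam_iff hc]
  have hpos : ∀ᶠ t in 𝓝[>] (0 : ℝ), 0 < t := self_mem_nhdsWithin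
  have hgap : ∀ᶠ t in 𝓝[>] (0 : ℝ),
      c (-1) - Ptilde g c (X + t * v.1) < Y + t * v.2 := by
    have ca : Continuous fun t : ℝ => c (-1) - Ptilde g c (X + t * v.1) :=
      continuous_const.sub (P_cont.comp (by fun_prop))
    have cb : Continuous fun t : ℝ => Y + t * v.2 := by fun_prop
    exact (ca.continuousAt.eventually_lt cb.continuousAt (by simp; linarith)).filter_mono
      nhdsWithin_le_nhds
  have hgap2 : ∀ᶠ t in 𝓝[>] (0 : ℝ), Y + t * v.2 < Ptilde g c (X + t * v.1) := by
    have ca : Continuous fun t : ℝ => Ptilde g c (X + t * v.1) :=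
      P_cont.comp (by fun_prop)
    have cb : Continuous fun t : ℝ => Y + t * v.2 := by fun_prop
    exact (cb.continuousAt.eventually_lt ca.continuousAt (by simp; linarith)).filter_mono
      nhdsWithin_le_nhds
  constructor
  · rintro ⟨hcop, hev⟩
    obtain ⟨t, ht0, htg, htg2, ⟨hcase, hr0, hr1⟩, hs1, hs2⟩ :=
      (hpos.and (hgap.and (hgap2.and
        (hev.and ((ev_small ε v.1 hε).and (ev_small ε (-v.1) hε)))))).exists
    obtain ⟨a, b⟩ := v
    simp only at *
    have hnd : ¬ DifferentiableAt ℝ (Ptilde g c) (X + t * a) := by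
      rcases hcase with h | h | h
      · linarith
      · linarith
      · exact h.2.2
    rcases lt_trichotomy a 0 with ha | ha | ha
    · have ha' : (a : ℝ) < 0 := by exact_mod_cast ha
      have hta : t * a < 0 := mul_neg_of_pos_of_neg ht0 ha'
      have hd := k2 (t * -a) (by linarith) hs2
      rw [show X - t * -(a : ℝ) = X + t * a by ring] at hd
      exact absurd hd hnd
    · subst ha
      have hb : b = 1 ∨ b = -1 := by
        have := isCoprime_zero_left.1 hcop
        exact Int.isUnit_iff.1 this
      rcases hb with rfl | rfl
      · exact Or.inl rfl
      · exact Or.inr rfl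
    · have ha' : (0 : ℝ) < a := by exact_mod_cast ha
      have hta : 0 < t * a := mul_pos ht0 ha'
      exact absurd (k1 (t * a) (by linarith) hs1) hnd
  · rintro (rfl | rfl)
    all_goals
      refine ⟨by simp [isCoprime_zero_left], ?_⟩
      filter_upwards [hgap, hgap2] with t t0 t1
      simp only [Int.cast_zero, mul_zero, add_zero] at *
      exact ⟨Or.inr (Or.inr ⟨t0, t1, hrl⟩), hX0, hX1⟩

lemma dirs_conj (hc : Hyp g c) (X Y : ℝ) (a b : ℤ) :
    (a, b) ∈ localDirs (Gam g c) (X, c (-1) - Y) ↔ (a, -b) ∈ localDirs (Gam g c) (X, Y) := by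
  rw [mem_localDirs, mem_localDirs]
  simp only [gam_iff hc, IsCoprime.neg_right_iff]
  refine and_congr_right fun _ => ?_
  refine eventually_congr (Eventually.of_forall fun t => ?_)
  refine and_congr_left fun _ => ?_
  push_cast
  constructor
  · rintro (h | h | ⟨h, h', h''⟩)
    · right; left; linarith
    · left; linarith
    · right; right; exact ⟨by linarith, by linarith, h''⟩
  · rintro (h | h | ⟨h, h', h''⟩)
    · right; left; linarith
    · left; linarith
    · right; right; exact ⟨by linarith, by linarith, h''⟩

lemma bal_upper (hc : Hyp g c) (hg2 : 2 ≤ g) (X : ℝ) (hX0 : c 0 - c 1 ≤ X) (hX1 : X ≤ 0) :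
    ∃ T : Finset (ℤ × ℤ), localDirs (Gam g c) (X, Ptilde g c X) = ↑T ∧
      ∀ α β : ℤ, 0 ≤ α →
        (X ≠ 0 → 0 ≤ ∑ v ∈ T, (α * v.1 + β * v.2)) ∧
        (X = 0 → ∑ v ∈ T, (α * v.1 + β * v.2) = - α - β * (g + 1)) := by
  obtain ⟨l, r, ε, hε, h1, h2, hlr, hz, hw⟩ := P_loc hc hg2 X
  have hd := dirs_upper hc X ε hX0 hX1 hε l r h1 h2
  have hd01 : c 0 - c 1 < 0 := by
    have := d_mono hc hg2 0 g (by omega) le_rfl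
    rw [hc.1, hc.2.1] at this
    simpa using this
  rcases hX1.lt_or_eq with hx1 | hx1
  · rcases hX0.lt_or_eq with hx0 | hx0
    · rcases hlr with h | h
      · refine ⟨{(1, r), (-1, -l)}, ?_, ?_⟩
        · ext v; rw [hd]; simp [hx1, hx0, h]
        · intro α β hα
          refine ⟨fun _ => ?_, fun h => by linarith⟩
          rw [Finset.sum_pair (by simp), h]
          apply le_of_eq; ring
      · refine ⟨{(1, r), (-1, -l), (0, -1)}, ?_, ?_⟩
        · ext v; rw [hd]; simp [hx1, hx0, h]
        · intro α β hα
          refine ⟨fun _ => ?_, fun h => by linarith⟩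
          rw [Finset.sum_insert (by simp), Finset.sum_pair (by simp), h]
          apply le_of_eq; ring
    · obtain ⟨rfl, rfl⟩ := hw hx0.symm
      refine ⟨{(1, 1), (0, -1)}, ?_, ?_⟩
      · ext v; rw [hd]; simp [hx1, hx0]
      · intro α β hα
        refine ⟨fun _ => ?_, fun h => by linarith⟩
        rw [Finset.sum_pair (by simp)]
        linarith
  · obtain ⟨rfl, rfl⟩ := hz hx1
    refine ⟨{(-1, -(g : ℤ)), (0, -1)}, ?_, ?_⟩
    · ext v; rw [hd]; simp [hx1, sub_neg.1 hd01]
    · intro α β hα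
      refine ⟨fun h => absurd hx1 h, fun _ => ?_⟩
      rw [Finset.sum_pair (by simp)]
      ring

lemma P_zero (hc : Hyp g c) (hg2 : 2 ≤ g) : Ptilde g c 0 = 0 := by
  apply le_antisymm
  · obtain ⟨l, r, ε, hε, h1, h2, hlr, hz, hw⟩ := P_loc hc hg2 0
    by_contra hcon
    push Not at hcon
    have key : ∀ k : ℕ, k ≤ g → c ((g - k : ℕ) : ℤ) ≤ 0 := by
      intro k
      induction k with
      | zero => intro _; simp [hc.2.1]
      | succ k ih =>
        intro hk
        have i1 := ih (by omega)
        have i2 := d_mono hc hg2 (g - (k + 1)) g (by omega) le_rfl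
        rw [hc.1, hc.2.1] at i2
        rw [show ((g - (k + 1) : ℕ) : ℤ) + 1 = ((g - k : ℕ) : ℤ) by omega] at i2
        linarith
    obtain ⟨i, hi, hM⟩ := P_ex (g := g) (c := c) 0
    simp only [mul_zero, add_zero] at hM
    rcases hi.lt_or_eq with h | h
    · have := key (g - i) (by omega)
      rw [show g - (g - i) = i by omega] at this
      linarith
    · rw [h] at hM
      have := hc.1
      push_cast at hM
      linarith
  · have := P_ge (g := g) (c := c) 0 g (by omega)
    simpa [hc.2.1] using this

lemma D_apply (hc : Hyp g c) (P : ℝ × ℝ) :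
    (3 • DstarEven g c) P = 3 * ((g / 2 : ℕ) : ℤ) *
      ((if P = (0, 0) then 1 else 0) + (if P = (0, c (-1)) then 1 else 0)) := by
  classical
  have hV : V g c 0 = (0, 0) := by
    simp [V, hc.1, hc.2.1]
  have hV' : conj c (V g c 0) = (0, c (-1)) := by
    rw [hV]; simp [conj]
  unfold DstarEven
  rw [hV', hV]
  simp only [Finsupp.smul_apply, Finsupp.add_apply, Finsupp.single_apply, smul_eq_mul,
    eq_comm (a := P)]
  rw [nsmul_eq_mul]
  push_cast
  ring

lemma bal (hc : Hyp g c) (hg2 : 2 ≤ g) (P : ℝ × ℝ) (hP : P ∈ Gam g c) :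
    ∃ T : Finset (ℤ × ℤ), localDirs (Gam g c) P = ↑T ∧
      ∀ α β : ℤ, 0 ≤ α → α + β * (g + 1) ≤ 3 * ((g / 2 : ℕ) : ℤ) →
        α - β * (g + 1) ≤ 3 * ((g / 2 : ℕ) : ℤ) →
        0 ≤ ∑ v ∈ T, (α * v.1 + β * v.2) + (3 • DstarEven g c) P := by
  classical
  obtain ⟨X, Y⟩ := P
  have hDpos : 0 ≤ (3 • DstarEven g c) (X, Y) := by
    rw [D_apply hc]; positivity
  obtain ⟨hcase, hX0, hX1⟩ := (gam_iff hc X Y).1 hP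
  rcases hcase with h | h | ⟨ha, hb, hd⟩
  · subst h
    obtain ⟨T, hT, hT2⟩ := bal_upper hc hg2 X hX0 hX1
    refine ⟨T, hT, fun α β hα h1 h2 => ?_⟩
    by_cases hX : X = 0
    · rw [(hT2 α β hα).2 hX]
      have : 3 * ((g / 2 : ℕ) : ℤ) ≤ (3 • DstarEven g c) (X, Ptilde g c X) := by
        rw [D_apply hc, if_pos (by rw [hX, P_zero hc hg2])]
        apply le_mul_of_one_le_right (by positivity)
        split_ifs <;> norm_num
      linarith
    · linarith [(hT2 α β hα).1 hX]
  · subst h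
    obtain ⟨T, hT, hT2⟩ := bal_upper hc hg2 X hX0 hX1
    refine ⟨T.image (fun v => (v.1, -v.2)), ?_, fun α β hα h1 h2 => ?_⟩
    · ext ⟨a, b⟩
      rw [dirs_conj hc, hT]
      simp only [Finset.coe_image, Set.mem_image, Finset.mem_coe, Prod.mk.injEq, Prod.exists]
      constructor
      · intro h; exact ⟨a, -b, h, rfl, by simp⟩
      · rintro ⟨a', b', h, rfl, rfl⟩; simpa using h
    · rw [Finset.sum_image (by
        rintro ⟨a, b⟩ _ ⟨a', b'⟩ _ h; simpa using h)]
      have e : ∑ v ∈ T, (α * v.1 + β * -v.2) = ∑ v ∈ T, (α * v.1 + (-β) * v.2) :=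
        Finset.sum_congr rfl fun v _ => by ring
      simp only
      rw [e]
      by_cases hX : X = 0
      · rw [(hT2 α (-β) hα).2 hX]
        have : 3 * ((g / 2 : ℕ) : ℤ) ≤ (3 • DstarEven g c) (X, c (-1) - Ptilde g c X) := by
          rw [D_apply hc, if_pos (c := (X, c (-1) - Ptilde g c X) = (0, c (-1)))
            (by rw [hX, P_zero hc hg2, sub_zero])]
          apply le_mul_of_one_le_right (by positivity)
          split_ifs <;> norm_num
        linarith
      · linarith [(hT2 α (-β) hα).1 hX]
  · obtain ⟨l, r, ε, hε, h1, h2, -⟩ := P_loc hc hg2 X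
    refine ⟨{(0, 1), (0, -1)}, ?_, fun α β hα _ _ => ?_⟩
    · ext v
      rw [dirs_middle hc X Y ε hX0 hX1 ha hb hε l r hd h1 h2]
      simp
    · rw [Finset.sum_pair (by simp)]
      linarith

lemma slope_eq (S : Set (ℝ × ℝ)) (f : ℝ × ℝ → ℝ) (P : ℝ × ℝ) (v : ℤ × ℤ) (s : ℤ)
    (hv : v ∈ localDirs S P) (hs : HasSlope S f P v s) : slope S f P v = s := by
  have hex : ∃ s, HasSlope S f P v s := ⟨s, hs⟩
  unfold slope
  rw [dif_pos hex]
  obtain ⟨e1, he1, h1⟩ := hex.choose_spec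
  obtain ⟨e2, he2, h2⟩ := hs
  obtain ⟨_, e3, he3, h3⟩ := hv
  obtain ⟨t, ht0, ht⟩ := exists_between (lt_min he1 (lt_min he2 he3))
  obtain ⟨ht1, ht'⟩ := lt_min_iff.1 ht
  obtain ⟨ht2, ht3⟩ := lt_min_iff.1 ht'
  have hm := h3 t ht0 ht3
  have a := h1 t ht0.le ht1 hm
  have b := h2 t ht0.le ht2 hm
  have : ((hex.choose : ℤ) : ℝ) = s := by
    apply mul_right_cancel₀ ht0.ne'
    linarith
  exact_mod_cast this

/-- Finite maxima of admissible monomials are in `R(3D*)`. -/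
lemma max_mem (hc : Hyp g c) (hg2 : 2 ≤ g) {ι : Type*} (s : Finset ι) (A : ι → ℝ)
    (α β : ι → ℤ)
    (hab : ∀ j ∈ s, 0 ≤ α j ∧ α j + β j * (g + 1) ≤ 3 * ((g / 2 : ℕ) : ℤ) ∧
      α j - β j * (g + 1) ≤ 3 * ((g / 2 : ℕ) : ℤ))
    (f : ℝ × ℝ → ℝ) (hf1 : ∀ P ∈ Gam g c, ∀ j ∈ s, A j + α j * P.1 + β j * P.2 ≤ f P)
    (hf2 : ∀ P ∈ Gam g c, ∃ j ∈ s, A j + α j * P.1 + β j * P.2 = f P) :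
    f ∈ RSet (Gam g c) (3 • DstarEven g c) := by
  have hslope : ∀ P ∈ Gam g c, ∀ v : ℤ × ℤ, ∃ i ∈ s, HasSlope (Gam g c) f P v
      (α i * v.1 + β i * v.2) ∧ ∀ j ∈ s, A j + α j * P.1 + β j * P.2 = f P →
        α j * v.1 + β j * v.2 ≤ α i * v.1 + β i * v.2 := by
    intro P hP v
    obtain ⟨i, hi, hiM, himax, ε, hε, h⟩ := localmax s (fun j => A j + α j * P.1 + β j * P.2)
      (fun j => ((α j * v.1 + β j * v.2 : ℤ) : ℝ)) (f P) (hf1 P hP) (hf2 P hP)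
    refine ⟨i, hi, ⟨ε, hε, fun t ht0 ht hm => ?_⟩, fun j hj hjM => by
      exact_mod_cast himax j hj hjM⟩
    have h' := h t ht0 ht
    obtain ⟨X, Y⟩ := P
    simp only [pt_add] at *
    have a1 := hf1 _ hm i hi
    obtain ⟨j, hj, hjM⟩ := hf2 _ hm
    have a2 := h' j hj
    push_cast at *
    apply le_antisymm
    · rw [← hjM]; linarith
    · linarith
  refine ⟨⟨?_, ?_⟩, ?_⟩
  · by_cases hs : s.Nonempty
    · have : ContinuousOn (fun P : ℝ × ℝ => s.sup' hs fun j => A j + α j * P.1 + β j * P.2)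
          (Gam g c) :=
        (Continuous.finset_sup'_apply _ fun i _ => by fun_prop).continuousOn
      refine this.congr fun P hP => ?_
      apply le_antisymm
      · obtain ⟨j, hj, h⟩ := hf2 P hP
        rw [← h]
        exact Finset.le_sup' (fun j => A j + α j * P.1 + β j * P.2) hj
      · exact Finset.sup'_le _ _ (hf1 P hP)
    · intro P hP
      obtain ⟨j, hj, _⟩ := hf2 P hP
      exact absurd ⟨j, hj⟩ hs
  · intro P hP v _
    obtain ⟨i, _, h, _⟩ := hslope P hP v
    exact ⟨_, h⟩
  · intro P hP
    obtain ⟨T, hT, hbal⟩ := bal hc hg2 P hP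
    obtain ⟨j, hj, hjM⟩ := hf2 P hP
    obtain ⟨q1, q2, q3⟩ := hab j hj
    have hb := hbal (α j) (β j) q1 q2 q3
    have ho : ord (Gam g c) f P = ∑ v ∈ T, slope (Gam g c) f P v := by
      unfold ord
      rw [hT]
      exact finsum_mem_coe_finset _ _
    rw [ho]
    have : ∑ v ∈ T, (α j * v.1 + β j * v.2) ≤ ∑ v ∈ T, slope (Gam g c) f P v := by
      refine Finset.sum_le_sum fun v hv => ?_
      have hv' : v ∈ localDirs (Gam g c) P := by rw [hT]; exact hv
      obtain ⟨i, hi, h, hmax⟩ := hslope P hP v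
      rw [slope_eq _ _ _ _ _ hv' h]
      exact hmax j hj hjM
    linarith

lemma Mg_mem (hc : Hyp g c) (hg : Even g) (hg2 : 2 ≤ g) (f : ℝ × ℝ → ℝ) (hf : InMgEven g c f) :
    f ∈ RSet (Gam g c) (3 • DstarEven g c) := by
  classical
  obtain ⟨a, b, h⟩ := hf
  obtain ⟨k, hk⟩ := hg
  have hk2 : g / 2 = k := by omega
  have hk3 : 3 * g / 2 = 3 * k := by omega
  rw [hk2, hk3] at h
  let C : ℕ ⊕ ℕ → EReal := Sum.elim a b
  let α : ℕ ⊕ ℕ → ℤ := Sum.elim (fun i => (i : ℤ)) (fun i => (i : ℤ))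
  let β : ℕ ⊕ ℕ → ℤ := Sum.elim (fun _ => 0) (fun _ => 1)
  let s0 := (Finset.range (3 * k + 1)).disjSum (Finset.range k)
  have hle : ∀ P ∈ Gam g c, ∀ j ∈ s0,
      C j + ((α j * P.1 + β j * P.2 : ℝ) : EReal) ≤ (f P : EReal) := by
    intro P hP j hj
    rw [h P hP]
    rcases j with i | i
    · have hi : i ∈ Finset.range (3 * k + 1) := by simpa [s0] using hj
      refine le_trans ?_ (le_max_left _ _)
      have := Finset.le_sup (f := fun i => a i + (((i : ℝ) * P.1 : ℝ) : EReal)) hi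
      simpa [C, α, β] using this
    · have hi : i ∈ Finset.range k := by simpa [s0] using hj
      refine le_trans ?_ (le_max_right _ _)
      have := Finset.le_sup (f := fun i => b i + (((i : ℝ) * P.1 + P.2 : ℝ) : EReal)) hi
      simpa [C, α, β] using this
  have hex : ∀ P ∈ Gam g c, ∃ j ∈ s0,
      C j + ((α j * P.1 + β j * P.2 : ℝ) : EReal) = (f P : EReal) := by
    intro P hP
    rw [h P hP]
    rcases max_choice ((Finset.range (3 * k + 1)).sup
            fun i => a i + (((i : ℝ) * P.1 : ℝ) : EReal))
          ((Finset.range k).sup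
            fun i => b i + (((i : ℝ) * P.1 + P.2 : ℝ) : EReal)) with e | e
    · obtain ⟨i, hi, hh⟩ := Finset.exists_mem_eq_sup (Finset.range (3 * k + 1))
        ⟨0, by simp⟩ (fun i => a i + (((i : ℝ) * P.1 : ℝ) : EReal))
      refine ⟨Sum.inl i, by simpa [s0] using hi, ?_⟩
      rw [e, hh]
      simp [C, α, β]
    · obtain ⟨i, hi, hh⟩ := Finset.exists_mem_eq_sup (Finset.range k)
        ⟨0, by simp; omega⟩ (fun i => b i + (((i : ℝ) * P.1 + P.2 : ℝ) : EReal))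
      refine ⟨Sum.inr i, by simpa [s0] using hi, ?_⟩
      rw [e, hh]
      simp [C, α, β]
  have hnt : ∀ P ∈ Gam g c, ∀ j ∈ s0, C j ≠ ⊤ := by
    intro P hP j hj htop
    have := hle P hP j hj
    rw [htop, EReal.top_add_coe, top_le_iff] at this
    exact EReal.coe_ne_top _ this
  refine max_mem hc hg2 (s0.filter fun j => C j ≠ ⊥) (fun j => (C j).toReal) α β ?_ f ?_ ?_
  · intro j hj
    have hj := (Finset.mem_filter.1 hj).1
    rw [hk2]
    rcases j with i | i
    · have hi : i < 3 * k + 1 := by simpa [s0] using hj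
      simp only [α, β, Sum.elim_inl]
      omega
    · have hi : i < k := by simpa [s0] using hj
      simp only [α, β, Sum.elim_inr]
      omega
  · intro P hP j hj
    obtain ⟨hj, hb⟩ := Finset.mem_filter.1 hj
    have h1 := hle P hP j hj
    rw [← EReal.coe_toReal (hnt P hP j hj) hb, ← EReal.coe_add, EReal.coe_le_coe_iff] at h1
    linarith
  · intro P hP
    obtain ⟨j, hj, h1⟩ := hex P hP
    have hb : C j ≠ ⊥ := by
      intro hb
      rw [hb, EReal.bot_add] at h1
      exact EReal.coe_ne_bot _ h1.symm
    refine ⟨j, Finset.mem_filter.2 ⟨hj, hb⟩, ?_⟩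
    rw [← EReal.coe_toReal (hnt P hP j hj) hb, ← EReal.coe_add, EReal.coe_eq_coe_iff] at h1
    linarith

lemma neg_y_mem (hc : Hyp g c) (hg : Even g) (hg2 : 2 ≤ g) :
    (fun P : ℝ × ℝ => -P.2) ∈ RSet (Gam g c) (3 • DstarEven g c) := by
  obtain ⟨k, hk⟩ := hg
  refine max_mem hc hg2 ({()} : Finset Unit) (fun _ => 0) (fun _ => 0) (fun _ => -1) ?_ _ ?_ ?_
  · intro j _
    omega
  · intro P _ j _
    simp
  · intro P _
    exact ⟨(), by simp, by simp⟩

lemma neg_y_not (hc : Hyp g c) (hg2 : 2 ≤ g) : ¬ InMgEven g c (fun P : ℝ × ℝ => -P.2) := by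
  rintro ⟨a, b, h⟩
  have hP := P_pos hc 0
  rw [P_zero hc hg2] at hP
  have hd01 : c 0 - c 1 < 0 := by
    have := d_mono hc hg2 0 g (by omega) le_rfl
    rw [hc.1, hc.2.1] at this
    simpa using this
  have m1 : ((0, 0) : ℝ × ℝ) ∈ Gam g c :=
    (gam_iff hc 0 0).2 ⟨Or.inl (P_zero hc hg2).symm, hd01.le, le_rfl⟩
  have m2 : ((0, c (-1)) : ℝ × ℝ) ∈ Gam g c :=
    (gam_iff hc 0 _).2 ⟨Or.inr (Or.inl (by rw [P_zero hc hg2, sub_zero])), hd01.le, le_rfl⟩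
  have e1 := h _ m1
  have e2 := h _ m2
  have : ((-c (-1) : ℝ) : EReal) ≤ ((-0 : ℝ) : EReal) := by
    refine (e2.le.trans ?_).trans e1.ge
    refine max_le_max le_rfl (Finset.sup_mono_fun fun i _ => ?_)
    refine add_le_add le_rfl ?_
    rw [EReal.coe_le_coe_iff]
    linarith
  rw [EReal.coe_le_coe_iff] at this
  linarith

end

end TropicalHyperelliptic

/-- Let `g` be even, `Γ` the bounded part of the tropical hyperelliptic curve of
genus `g`, and `D* = (g/2)(V_0 + V_0′)`.  The tropical module `𝓜_g` is a
proper subset of `R(3D*)`: every element of `𝓜_g` lies in `R(3D*)`, but some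
rational function in `R(3D*)` does not belong to `𝓜_g`. -/
theorem Mg_proper_subset_R_even (g : ℕ) (c : ℤ → ℝ) (hg : Even g) (hg2 : 2 ≤ g)
    (hc : Hyp g c) :
    (∀ f : (ℝ × ℝ) → ℝ, InMgEven g c f → f ∈ RSet (Gam g c) (3 • DstarEven g c))
    ∧ (∃ f ∈ RSet (Gam g c) (3 • DstarEven g c), ¬ InMgEven g c f) := by
  exact ⟨fun f hf => Mg_mem hc hg hg2 f hf, _, neg_y_mem hc hg hg2, neg_y_not hc hg2⟩
end

section
/- Let g be even and let C ⊂ ℝ² be the tropical plane curve of degree 3g/2 defined by h ∈ 𝓜_g satisfying the generic condition (a_i + a_{i+2} < 2a_{i+1} for 0 ≤ i ≤ 3g/2 − 2; b_i + b_{i+2} < 2b_{i+1} for 0 ≤ i ≤ g/2 − 3; a_1 − a_0 < b_0 − b_1). Then the tropical hyperelliptic curve Γ̄ of genus g intersects C with multiplicity 3g²/2 at the point P_∞ = (−∞ : 0 : −∞) at infinity of the tropical projective plane 𝕋ℙ². -/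
open scoped BigOperators

namespace TropicalHyperelliptic

/-- For even `g`, the tropical polynomial of degree `3g/2` with (real)
coefficients `a_0, …, a_{3g/2}` and `b_0, …, b_{g/2−1}`:
`h(X,Y) = max( max_{0≤i≤3g/2}(a_{3g/2−i} + iX), max_{0≤i≤g/2−1}(b_i + iX + Y) )`.
(For `g ≥ 2` the index set `insert 0 (range (g/2))` equals `range (g/2)`.) -/
noncomputable def MfunEven (g : ℕ) (a b : ℕ → ℝ) (P : ℝ × ℝ) : ℝ :=
  max ((Finset.range (3 * g / 2 + 1)).sup'
        (Finset.nonempty_range_iff.mpr (by omega))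
        fun i => a (3 * g / 2 - i) + (i : ℝ) * P.1)
      ((insert 0 (Finset.range (g / 2))).sup' (Finset.insert_nonempty _ _)
        fun i => b i + (i : ℝ) * P.1 + P.2)

/-- The generic condition on the coefficients of `h ∈ 𝓜_g` (even `g`):
`a_i + a_{i+2} < 2a_{i+1}` for `0 ≤ i ≤ 3g/2 − 2`, `b_i + b_{i+2} < 2b_{i+1}`
for `0 ≤ i ≤ g/2 − 3`, and `a_1 − a_0 < b_0 − b_1`.  Under this condition the
curve `C` of `h` is smooth with exactly `2g − 1` vertices. -/
def GenCondEven (g : ℕ) (a b : ℕ → ℝ) : Prop :=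
  (∀ i : ℕ, i + 2 ≤ 3 * g / 2 → a i + a (i + 2) < 2 * a (i + 1))
  ∧ (∀ i : ℕ, i + 2 ≤ g / 2 - 1 → b i + b (i + 2) < 2 * b (i + 1))
  ∧ a 1 - a 0 < b 0 - b 1

/-- The offsets of the unbounded rays of `S` in the primitive direction `v`:
each unbounded edge of `S` of direction `v` contributes the (constant) value
`v₁·p₂ − v₂·p₁` along it, so distinct parallel unbounded edges give distinct
offsets. -/
def rayOffsets (S : Set (ℝ × ℝ)) (v : ℤ × ℤ) : Set ℝ :=
  {o | ∃ p ∈ S, (v.1 : ℝ) * p.2 - (v.2 : ℝ) * p.1 = o ∧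
        ∀ t : ℝ, 0 ≤ t → p + t • vr v ∈ S}

/-- The primitive directions of the unbounded edges of `S` heading to the point
`P_∞ = (−∞ : 0 : −∞)` at infinity of `𝕋ℙ²` (in the affine chart
`(X, Y) = (x_0 − x_2, x_1 − x_2)` these are the directions `v` with
`v₁ < v₂` and `0 < v₂`). -/
def pinfDirs (S : Set (ℝ × ℝ)) : Set (ℤ × ℤ) :=
  {v | IsCoprime v.1 v.2 ∧ v.1 < v.2 ∧ 0 < v.2 ∧ (rayOffsets S v).Nonempty}

/-- The intersection multiplicity of two tropical plane curves `S`, `C` at the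
point `P_∞` at infinity: the sum, over all pairs of unbounded edges of `S` and
of `C` through `P_∞` (all of weight `1` here), of `min(ad, bc)`, where `(a,b)`
and `(c,d)` are the primitive tangent vectors of the two edges written in the
basis `(−1,0)`, `(1,1)` (for a standard direction `v` these coordinates are
`(v₂ − v₁, v₂)`). -/
noncomputable def multAtPinf (S C : Set (ℝ × ℝ)) : ℤ :=
  ∑ᶠ v ∈ pinfDirs S, ∑ᶠ w ∈ pinfDirs C,
    ((rayOffsets S v).ncard : ℤ) * ((rayOffsets C w).ncard : ℤ) *
      min ((v.2 - v.1) * w.2) (v.2 * (w.2 - w.1))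

end TropicalHyperelliptic

open TropicalHyperelliptic

/-- One-variable tropical polynomial of degree `n`. -/
noncomputable def TP (n : ℕ) (d : ℕ → ℝ) (X : ℝ) : ℝ :=
  (Finset.range (n + 1)).sup' (Finset.nonempty_range_iff.mpr (by omega))
    fun i => d i + (i : ℝ) * X

lemma TP_ge (n : ℕ) (d : ℕ → ℝ) (X : ℝ) {i : ℕ} (hi : i ≤ n) : d i + (i : ℝ) * X ≤ TP n d X :=
  Finset.le_sup' (fun i : ℕ => d i + (i : ℝ) * X) (Finset.mem_range.mpr (by omega))

lemma TP_le (n : ℕ) (d : ℕ → ℝ) (X M : ℝ) (h : ∀ i ≤ n, d i + (i : ℝ) * X ≤ M) : TP n d X ≤ M :=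
  Finset.sup'_le _ _ fun i hi => h i (by have := Finset.mem_range.mp hi; omega)

lemma TP_exists (n : ℕ) (d : ℕ → ℝ) (X : ℝ) : ∃ i ≤ n, TP n d X = d i + (i : ℝ) * X := by
  obtain ⟨i, hi, h⟩ := Finset.exists_mem_eq_sup' (s := Finset.range (n + 1))
    (Finset.nonempty_range_iff.mpr (by omega)) (fun i : ℕ => d i + (i : ℝ) * X)
  exact ⟨i, by have := Finset.mem_range.mp hi; omega, h⟩

lemma TP_cont (n : ℕ) (d : ℕ → ℝ) : Continuous (TP n d) := by
  unfold TP
  exact Continuous.finset_sup'_apply _ fun i _ => by fun_prop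

lemma TP_mono (n : ℕ) (d : ℕ → ℝ) : Monotone (TP n d) := by
  intro x y h
  refine TP_le _ _ _ _ fun i hi => le_trans ?_ (TP_ge n d y hi)
  gcongr

lemma TP_top (n : ℕ) (d : ℕ → ℝ) : ∃ K : ℝ, ∀ X > K, TP n d X = d n + (n : ℝ) * X := by
  refine ⟨∑ i ∈ Finset.range (n + 1), |d i - d n|, fun X hX => ?_⟩
  refine le_antisymm (TP_le _ _ _ _ fun i hi => ?_) (TP_ge n d X le_rfl)
  have h1 : |d i - d n| ≤ ∑ i ∈ Finset.range (n + 1), |d i - d n| :=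
    Finset.single_le_sum (f := fun i => |d i - d n|) (fun _ _ => abs_nonneg _)
      (Finset.mem_range.mpr (by omega))
  have h2 := le_abs_self (d i - d n)
  have h3 := abs_nonneg (d i - d n)
  rcases hi.eq_or_lt with rfl | hlt
  · exact le_rfl
  · have h4 : (i : ℝ) + 1 ≤ n := by exact_mod_cast hlt
    nlinarith

lemma TP_bot (n : ℕ) (d : ℕ → ℝ) : ∃ K : ℝ, ∀ X < K, TP n d X = d 0 := by
  refine ⟨-∑ i ∈ Finset.range (n + 1), |d i - d 0|, fun X hX => ?_⟩
  refine le_antisymm (TP_le _ _ _ _ fun i hi => ?_) (by simpa using TP_ge n d X (Nat.zero_le n))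
  have h1 : |d i - d 0| ≤ ∑ i ∈ Finset.range (n + 1), |d i - d 0| :=
    Finset.single_le_sum (f := fun i => |d i - d 0|) (fun _ _ => abs_nonneg _)
      (Finset.mem_range.mpr (by omega))
  have h2 := le_abs_self (d i - d 0)
  have h3 := abs_nonneg (d i - d 0)
  rcases Nat.eq_zero_or_pos i with rfl | hlt
  · simp
  · have h4 : (1 : ℝ) ≤ i := by exact_mod_cast hlt
    nlinarith

lemma touch {f : ℝ → ℝ} {x d s : ℝ} (hf : DifferentiableAt ℝ f x) (h : ∀ y, d + s * y ≤ f y)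
    (hx : f x = d + s * x) : deriv f x = s := by
  have hm : IsLocalMin (fun y => f y - (d + s * y)) x := by
    refine Filter.Eventually.of_forall fun y => ?_
    have := h y
    simp only [hx]
    linarith
  have hd : HasDerivAt (fun y => f y - (d + s * y)) (deriv f x - s) x := by
    have h2 : HasDerivAt (fun y : ℝ => d + s * y) s x := by
      simpa using ((hasDerivAt_id x).const_mul s).const_add d
    exact hf.hasDerivAt.sub h2
  have := hm.hasDerivAt_eq_zero hd
  linarith

lemma not_diff_max (u : ℝ) : ¬ DifferentiableAt ℝ (fun y : ℝ => max y u) u := by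
  intro h
  have h0 := touch (d := u) (s := 0) h (fun y => by simp) (by simp)
  have h1 := touch (d := 0) (s := 1) h (fun y => by simp) (by simp)
  rw [h0] at h1
  exact zero_ne_one h1

lemma max_diff_left {f k : ℝ × ℝ → ℝ} {P : ℝ × ℝ} (hf : Continuous f) (hk : Continuous k)
    (h : k P < f P) :
    (fun Q => max (f Q) (k Q)) =ᶠ[nhds P] f := by
  filter_upwards [hk.continuousAt.eventually_lt hf.continuousAt h] with Q hQ
  exact max_eq_left hQ.le

lemma max_diff_right {f k : ℝ × ℝ → ℝ} {P : ℝ × ℝ} (hf : Continuous f) (hk : Continuous k)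
    (h : f P < k P) :
    (fun Q => max (f Q) (k Q)) =ᶠ[nhds P] k := by
  filter_upwards [hf.continuousAt.eventually_lt hk.continuousAt h] with Q hQ
  exact max_eq_right hQ.le

/-- slope-gap sequence is strictly increasing. -/
lemma gaps_mono {m : ℕ} {b : ℕ → ℝ} (hb : ∀ i, i + 2 ≤ m → b i + b (i + 2) < 2 * b (i + 1))
    {i j : ℕ} (hij : i < j) (hj : j < m) : b i - b (i + 1) < b j - b (j + 1) := by
  induction j, hij using Nat.le_induction with
  | base => have := hb i (by omega); simp only [Nat.succ_eq_add_one, add_assoc] at *; norm_num at *; linarith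
  | succ k hk ih =>
    have h1 := ih (by omega)
    have h2 := hb k (by omega)
    simp only [add_assoc] at *; norm_num at *; linarith

lemma go_down {m : ℕ} {b : ℕ → ℝ} {X : ℝ} {i : ℕ}
    (h : ∀ l, i ≤ l → l < m → X < b l - b (l + 1)) {j : ℕ} (hij : i < j) (hj : j ≤ m) :
    b j + (j : ℝ) * X < b i + (i : ℝ) * X := by
  induction j, hij using Nat.le_induction with
  | base => have := h i le_rfl (by omega); push_cast; linarith
  | succ k hk ih =>
    have h1 := ih (by omega)
    have h2 := h k (by omega) (by omega)
    push_cast; linarith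

lemma go_up {b : ℕ → ℝ} {X : ℝ} {i : ℕ}
    (h : ∀ l, l < i → b l - b (l + 1) < X) {j : ℕ} (hij : j < i) :
    b j + (j : ℝ) * X < b i + (i : ℝ) * X := by
  induction i, hij using Nat.le_induction with
  | base => have := h j (by omega); push_cast; linarith
  | succ k hk ih =>
    have h1 := ih fun l hl => h l (by omega)
    have h2 := h k (by omega)
    push_cast; linarith

lemma TP_diff_iff {m : ℕ} {b : ℕ → ℝ} (hb : ∀ i, i + 2 ≤ m → b i + b (i + 2) < 2 * b (i + 1))
    (X : ℝ) : ¬ DifferentiableAt ℝ (TP m b) X ↔ X ∈ (fun i => b i - b (i + 1)) '' Set.Iio m := by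
  constructor
  · intro hnd
    by_contra hX
    apply hnd
    have hX' : ∀ l < m, X ≠ b l - b (l + 1) := fun l hl h => hX ⟨l, hl, h.symm⟩
    obtain ⟨i, him, hi⟩ := TP_exists m b X
    have hdn : ∀ l, i ≤ l → l < m → X < b l - b (l + 1) := by
      intro l hil hlm
      have h0 : X < b i - b (i + 1) := by
        refine lt_of_le_of_ne ?_ (hX' i (by omega))
        have := TP_ge m b X (i := i + 1) (by omega)
        rw [hi] at this
        push_cast at this; linarith
      rcases hil.eq_or_lt with rfl | hlt
      · exact h0
      · exact h0.trans (gaps_mono hb hlt hlm)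
    have hup : ∀ l, l < i → b l - b (l + 1) < X := by
      intro l hl
      obtain ⟨k, rfl⟩ : ∃ k, i = k + 1 := ⟨i - 1, by omega⟩
      have h0 : b k - b (k + 1) < X := by
        refine lt_of_le_of_ne ?_ (hX' k (by omega)).symm
        have := TP_ge m b X (i := k) (by omega)
        rw [hi] at this
        push_cast at this; linarith
      rcases (Nat.lt_succ_iff.mp hl).eq_or_lt with rfl | hlt
      · exact h0
      · exact (gaps_mono hb hlt (by omega)).trans h0
    have key : TP m b =ᶠ[nhds X] fun x => b i + (i : ℝ) * x := by
      have : ∀ j ∈ Finset.range (m + 1), ∀ᶠ x in nhds X, b j + (j : ℝ) * x ≤ b i + (i : ℝ) * x := by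
        intro j hj
        have hj := Finset.mem_range.mp hj
        rcases lt_trichotomy j i with h | rfl | h
        · have := go_up hup h
          have h1 : ContinuousAt (fun x : ℝ => b j + (j : ℝ) * x) X := by fun_prop
          have h2 : ContinuousAt (fun x : ℝ => b i + (i : ℝ) * x) X := by fun_prop
          exact (h1.eventually_lt h2 this).mono fun x hx => hx.le
        · exact Filter.Eventually.of_forall fun x => le_rfl
        · have := go_down hdn h (by omega)
          have h1 : ContinuousAt (fun x : ℝ => b j + (j : ℝ) * x) X := by fun_prop
          have h2 : ContinuousAt (fun x : ℝ => b i + (i : ℝ) * x) X := by fun_prop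
          exact (h1.eventually_lt h2 this).mono fun x hx => hx.le
      filter_upwards [(Filter.eventually_all_finset _).mpr this] with x hx
      exact le_antisymm (TP_le _ _ _ _ fun j hj => hx j (Finset.mem_range.mpr (by omega)))
        (TP_ge m b x him)
    rw [key.differentiableAt_iff]
    fun_prop
  · rintro ⟨i, hi, rfl⟩ hd
    have hi : i < m := hi
    simp only at hd
    set X := b i - b (i + 1) with hX
    have e : b (i + 1) + ((i + 1 : ℕ) : ℝ) * X = b i + (i : ℝ) * X := by
      push_cast; rw [hX]; ring
    have hT : TP m b X = b i + (i : ℝ) * X := by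
      refine le_antisymm (TP_le _ _ _ _ fun j hj => ?_) (TP_ge m b X hi.le)
      rcases lt_trichotomy j i with h | rfl | h
      · exact (go_up (X := X) (fun l hl => gaps_mono (i := l) (j := i) hb hl hi) h).le
      · exact le_rfl
      · rcases (Nat.succ_le_of_lt h).eq_or_lt with rfl | h
        · exact e.le
        · rw [← e]
          exact (go_down (m := m) (X := X) (fun l hl hlm => gaps_mono (i := i) (j := l) hb (by omega) hlm) h hj).le
    have h0 := touch (d := b i) (s := i) hd (fun y => TP_ge m b y hi.le) hT
    have h1 := touch (d := b (i + 1)) (s := ((i + 1 : ℕ) : ℝ)) hd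
      (fun y => TP_ge m b y (by omega)) (hT.trans e.symm)
    rw [h0] at h1
    push_cast at h1
    linarith

/-- Asymptotic description of a tropical curve in the directions to `P_∞`. -/
structure Asym (S : Set (ℝ × ℝ)) (n : ℕ) (k : ℝ) (BP : Set ℝ) : Prop where
  right : ∃ K : ℝ, ∀ X > K, ∀ Y > K, ((X, Y) ∈ S ↔ Y = n * X + k)
  left : ∃ K : ℝ, ∀ X < -K, ∀ Y > K, (X, Y) ∉ S
  vert : ∀ X : ℝ, ∃ K : ℝ, ∀ Y > K, ((X, Y) ∈ S ↔ X ∈ BP)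

lemma ev_gt (p s K : ℝ) (hs : 0 < s) : ∀ᶠ t : ℝ in Filter.atTop, K < p + t * s :=
  (Filter.tendsto_atTop_add_const_left _ p
    (Filter.tendsto_id.atTop_mul_const hs)).eventually_gt_atTop K

lemma vr_pt (p : ℝ × ℝ) (t : ℝ) (v : ℤ × ℤ) :
    p + t • vr v = (p.1 + t * v.1, p.2 + t * v.2) := by
  ext <;> simp [vr]

lemma Asym.right_dir {S n k BP} (h : Asym S n k BP) {v : ℤ × ℤ} (h1 : 0 < v.1) (h2 : 0 < v.2)
    {p : ℝ × ℝ} (hp : ∀ t : ℝ, 0 ≤ t → p + t • vr v ∈ S) :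
    v.2 = n * v.1 ∧ p.2 = n * p.1 + k := by
  obtain ⟨K, hK⟩ := h.right
  have e1 := ev_gt p.1 v.1 K (by exact_mod_cast h1)
  have e2 := ev_gt p.2 v.2 K (by exact_mod_cast h2)
  obtain ⟨T, hT⟩ := Filter.eventually_atTop.mp ((e1.and e2).and (Filter.eventually_ge_atTop 0))
  have A : ∀ t ≥ T, p.2 + t * v.2 = n * (p.1 + t * v.1) + k := by
    intro t ht
    obtain ⟨⟨x1, x2⟩, x3⟩ := hT t ht
    have := hp t x3
    rw [vr_pt] at this
    exact (hK _ x1 _ x2).mp this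
  have A1 := A T le_rfl
  have A2 := A (T + 1) (by linarith)
  have A3 : (v.2 : ℝ) = n * v.1 := by linarith
  refine ⟨by exact_mod_cast A3, ?_⟩
  rw [A3] at A1
  linarith

lemma Asym.offsets_right {S n k BP} (h : Asym S n k BP) (hn : 0 < n) :
    rayOffsets S (1, (n : ℤ)) = {k} := by
  have hn' : (1 : ℝ) ≤ n := by exact_mod_cast hn
  ext o
  simp only [rayOffsets, Set.mem_ofPred_eq, Set.mem_singleton_iff]
  constructor
  · rintro ⟨p, _, rfl, hp⟩
    have := (h.right_dir (v := (1, (n : ℤ))) (by simp) (by simpa using hn) hp).2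
    push_cast
    linarith
  · rintro rfl
    obtain ⟨K, hK⟩ := h.right
    have key : ∀ t : ℝ, 0 ≤ t → (|K| + |o| + 1, n * (|K| + |o| + 1) + o) + t • vr (1, (n : ℤ)) ∈ S := by
      intro t ht
      rw [vr_pt]
      have a1 := le_abs_self K
      have a2 := neg_abs_le o
      have a3 := abs_nonneg K
      have a4 := abs_nonneg o
      refine (hK _ ?_ _ ?_).mpr ?_
      · push_cast; linarith
      · push_cast; nlinarith
      · push_cast; ring
    refine ⟨(|K| + |o| + 1, n * (|K| + |o| + 1) + o), by simpa using key 0 le_rfl, ?_, key⟩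
    push_cast; ring

lemma Asym.offsets_vert {S n k BP} (h : Asym S n k BP) :
    rayOffsets S (0, 1) = (fun x => -x) '' BP := by
  ext o
  simp only [rayOffsets, Set.mem_ofPred_eq, Set.mem_image]
  constructor
  · rintro ⟨p, _, rfl, hp⟩
    refine ⟨p.1, ?_, by simp⟩
    obtain ⟨K, hK⟩ := h.vert p.1
    refine (hK (max (K + 1) p.2) (lt_of_lt_of_le (by linarith) (le_max_left _ _))).mp ?_
    have := hp (max (K + 1) p.2 - p.2) (by linarith [le_max_right (K + 1) p.2])
    rw [vr_pt] at this
    simpa using this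
  · rintro ⟨x, hx, rfl⟩
    obtain ⟨K, hK⟩ := h.vert x
    have key : ∀ t : ℝ, 0 ≤ t → (x, K + 1) + t • vr (0, 1) ∈ S := by
      intro t ht
      rw [vr_pt]
      have := (hK (K + 1 + t) (by linarith)).mpr hx
      simpa using this
    exact ⟨(x, K + 1), by simpa using key 0 le_rfl, by simp, key⟩

lemma Asym.dirs {S n k BP} (h : Asym S n k BP) {v : ℤ × ℤ} (hv : v ∈ pinfDirs S) :
    v = (1, (n : ℤ)) ∨ (v = (0, 1) ∧ BP.Nonempty) := by
  obtain ⟨hc, _, h2, ho⟩ := hv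
  rcases lt_trichotomy v.1 0 with h1 | h1 | h1
  · exfalso
    obtain ⟨o, p, _, _, hp⟩ := ho
    obtain ⟨K, hK⟩ := h.left
    have e1 := ev_gt (-p.1) (-v.1) K (by simpa using h1)
    have e2 := ev_gt p.2 v.2 K (by exact_mod_cast h2)
    obtain ⟨t, ⟨x1, x2⟩, x3⟩ := ((e1.and e2).and (Filter.eventually_ge_atTop 0)).exists
    have := hp t x3
    rw [vr_pt] at this
    exact hK _ (by linarith) _ x2 this
  · right
    have hv : v = (0, 1) := by
      obtain ⟨x, y⟩ := v
      simp only at h1 h2 hc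
      subst h1
      have : IsUnit y := isCoprime_zero_left.mp hc
      rcases Int.isUnit_iff.mp this with rfl | rfl
      · rfl
      · omega
    refine ⟨hv, ?_⟩
    rw [hv, h.offsets_vert] at ho
    exact Set.image_nonempty.mp ho
  · left
    obtain ⟨o, p, _, _, hp⟩ := ho
    have := (h.right_dir h1 h2 hp).1
    obtain ⟨x, y⟩ := v
    simp only at this hc h1
    subst this
    have hu : IsUnit x := hc.isUnit_of_dvd' dvd_rfl (Dvd.intro_left _ rfl)
    rcases Int.isUnit_iff.mp hu with rfl | rfl
    · simp
    · omega

lemma Asym.mem_right {S n k BP} (h : Asym S n k BP) (hn : 1 < n) : (1, (n : ℤ)) ∈ pinfDirs S := by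
  refine ⟨isCoprime_one_left, by simpa using hn, by simp; omega, ?_⟩
  rw [h.offsets_right (by omega)]
  exact Set.singleton_nonempty _

lemma Asym.mem_vert {S n k BP} (h : Asym S n k BP) (hB : BP.Nonempty) : ((0 : ℤ), (1 : ℤ)) ∈ pinfDirs S := by
  refine ⟨isCoprime_one_right, by simp, by simp, ?_⟩
  rw [h.offsets_vert]
  exact hB.image _

lemma Asym.sum {S n k BP} (h : Asym S n k BP) (hn : 1 < n) (f : ℤ × ℤ → ℤ) :
    ∑ᶠ v ∈ pinfDirs S, ((rayOffsets S v).ncard : ℤ) * f v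
      = f (1, (n : ℤ)) + (BP.ncard : ℤ) * f (0, 1) := by
  have e1 : (rayOffsets S (1, (n : ℤ))).ncard = 1 := by
    rw [h.offsets_right (by omega), Set.ncard_singleton]
  have e2 : (rayOffsets S (0, 1)).ncard = BP.ncard := by
    rw [h.offsets_vert, Set.ncard_image_of_injective _ neg_injective]
  rcases BP.eq_empty_or_nonempty with hB | hB
  · have : pinfDirs S = {(1, (n : ℤ))} := by
      ext v
      constructor
      · intro hv
        rcases h.dirs hv with h | ⟨_, h⟩
        · exact h
        · simp [hB] at h
      · rintro rfl
        exact h.mem_right hn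
    rw [this, finsum_mem_singleton, e1, hB]
    simp
  · have : pinfDirs S = {(1, (n : ℤ)), (0, 1)} := by
      ext v
      constructor
      · intro hv
        rcases h.dirs hv with h | ⟨h, _⟩
        · exact Or.inl h
        · exact Or.inr h
      · rintro (rfl | rfl)
        · exact h.mem_right hn
        · exact h.mem_vert hB
    rw [this, finsum_mem_pair (by simp), e1, e2]
    simp

lemma asym_curveBar (g : ℕ) (c : ℤ → ℝ) (hc : Hyp g c) : Asym (curveBar g c) (g + 1) 0 ∅ := by
  have hF : Ftilde g c = fun P => max (2 * P.2)
      (max (P.2 + TP (g + 1) (fun i => c i) P.1) (c (-1))) := rfl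
  set T := TP (g + 1) (fun i => c i) with hT
  have hTc : Continuous T := TP_cont _ _
  have diff2 : ∀ X Y : ℝ, T X < Y → c (-1) < 2 * Y → (X, Y) ∉ curveBar g c := by
    intro X Y h1 h2
    simp only [curveBar, Set.mem_ofPred_eq, not_not]
    rw [hF, (max_diff_left (by fun_prop) (by fun_prop) (by simp; constructor <;> linarith)).differentiableAt_iff]
    fun_prop
  refine ⟨?_, ?_, ?_⟩
  · obtain ⟨K, hK⟩ := TP_top (g + 1) (fun i => c i)
    have htop : ∀ X > K, T X = ((g + 1 : ℕ) : ℝ) * X := by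
      intro X hX
      have := hK X hX
      rw [hT, this]
      have h0 := hc.1
      push_cast
      rw [h0, zero_add]
    refine ⟨max K (|c (-1)|), fun X hX Y hY => ?_⟩
    have hXK : K < X := lt_of_le_of_lt (le_max_left _ _) hX
    have hYc : |c (-1)| < Y := lt_of_le_of_lt (le_max_right _ _) hY
    have hc1 := le_abs_self (c (-1))
    have hc2 := abs_nonneg (c (-1))
    rw [add_zero, ← htop X hXK]
    constructor
    · intro hmem
      by_contra hne
      rcases lt_or_gt_of_ne hne with h | h
      · apply hmem
        rw [hF, (max_diff_right (by fun_prop) (by fun_prop) (by simp; left; linarith)).differentiableAt_iff,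
          (max_diff_left (by fun_prop) (by fun_prop) (by simp; linarith)).differentiableAt_iff]
        have : (fun P : ℝ × ℝ => P.2 + T P.1) =ᶠ[nhds (X, Y)]
            fun P => P.2 + ((g + 1 : ℕ) : ℝ) * P.1 := by
          have : ∀ᶠ P : ℝ × ℝ in nhds (X, Y), K < P.1 :=
            continuousAt_const.eventually_lt continuous_fst.continuousAt hXK
          filter_upwards [this] with P hP
          rw [htop _ hP]
        rw [this.differentiableAt_iff]
        fun_prop
      · exact diff2 X Y h (by linarith) hmem
    · intro hY hd
      rw [hF] at hd
      have hd2 : DifferentiableAt ℝ (fun y : ℝ => max (2 * y) (max (y + T X) (c (-1)))) Y :=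
        DifferentiableAt.comp (f := fun y : ℝ => (X, y)) Y hd (by fun_prop)
      have e : (fun y : ℝ => max (2 * y) (max (y + T X) (c (-1)))) =ᶠ[nhds Y]
          fun y => y + max y (T X) := by
        have : ∀ᶠ y : ℝ in nhds Y, |c (-1)| < y := lt_mem_nhds hYc
        filter_upwards [this] with y hy
        rw [← max_assoc, max_eq_left, two_mul, max_add_add_left]
        exact le_trans (by linarith) (le_max_left _ _)
      rw [e.differentiableAt_iff] at hd2
      have h3 := hd2.sub differentiableAt_id
      rw [← hY] at h3
      refine not_diff_max Y (h3.congr_of_eventuallyEq (Filter.Eventually.of_forall fun y => ?_))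
      simp
  · refine ⟨max 0 (max (T 0) (|c (-1)|)), fun X hX Y hY => ?_⟩
    have h0 := le_max_left 0 (max (T 0) (|c (-1)|))
    have h1 := (le_max_left (T 0) (|c (-1)|)).trans (le_max_right 0 _)
    have h2 := (le_max_right (T 0) (|c (-1)|)).trans (le_max_right 0 _)
    have h3 : T X ≤ T 0 := TP_mono _ _ (by linarith)
    exact diff2 X Y (by linarith) (by linarith [le_abs_self (c (-1))])
  · intro X
    refine ⟨max (T X) (|c (-1)|), fun Y hY => ?_⟩
    have h1 := le_max_left (T X) (|c (-1)|)
    have h2 := le_max_right (T X) (|c (-1)|)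
    have := diff2 X Y (by linarith) (by linarith [le_abs_self (c (-1)), abs_nonneg (c (-1))])
    simp [this]

lemma asym_two (N m n : ℕ) (hN : N = m + n) (a b : ℕ → ℝ)
    (hb : ∀ i, i + 2 ≤ m → b i + b (i + 2) < 2 * b (i + 1)) :
    Asym {P | ¬ DifferentiableAt ℝ (fun P : ℝ × ℝ => max (TP N a P.1) (TP m b P.1 + P.2)) P} n
      (a N - b m) ((fun i => b i - b (i + 1)) '' Set.Iio m) := by
  have hA : Continuous (TP N a) := TP_cont _ _
  have hB : Continuous (TP m b) := TP_cont _ _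
  have up : ∀ X Y : ℝ, TP N a X < TP m b X + Y →
      (¬ DifferentiableAt ℝ (fun P : ℝ × ℝ => max (TP N a P.1) (TP m b P.1 + P.2)) (X, Y) ↔
        X ∈ (fun i => b i - b (i + 1)) '' Set.Iio m) := by
    intro X Y h
    rw [(max_diff_right (by fun_prop) (by fun_prop) (by simpa using h)).differentiableAt_iff,
      ← TP_diff_iff hb, not_iff_not]
    constructor
    · intro hd
      have hd2 : DifferentiableAt ℝ (fun x : ℝ => TP m b x + Y) X :=
        DifferentiableAt.comp (f := fun x : ℝ => (x, Y)) X hd (by fun_prop)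
      simpa using hd2
    · intro hd
      have : DifferentiableAt ℝ (fun P : ℝ × ℝ => TP m b P.1) (X, Y) :=
        DifferentiableAt.comp (f := fun P : ℝ × ℝ => P.1) (X, Y) hd (by fun_prop)
      exact this.add (by fun_prop)
  refine ⟨?_, ?_, ?_⟩
  · obtain ⟨K1, hK1⟩ := TP_top N a
    obtain ⟨K2, hK2⟩ := TP_top m b
    refine ⟨max K1 K2, fun X hX Y _ => ?_⟩
    have hX1 : K1 < X := lt_of_le_of_lt (le_max_left _ _) hX
    have hX2 : K2 < X := lt_of_le_of_lt (le_max_right _ _) hX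
    have e : (fun P : ℝ × ℝ => max (TP N a P.1) (TP m b P.1 + P.2)) =ᶠ[nhds (X, Y)]
        fun P => max (a N + (N : ℝ) * P.1) (b m + (m : ℝ) * P.1 + P.2) := by
      have h1 : ∀ᶠ P : ℝ × ℝ in nhds (X, Y), K1 < P.1 :=
        continuousAt_const.eventually_lt continuous_fst.continuousAt hX1
      have h2 : ∀ᶠ P : ℝ × ℝ in nhds (X, Y), K2 < P.1 :=
        continuousAt_const.eventually_lt continuous_fst.continuousAt hX2
      filter_upwards [h1, h2] with P hP1 hP2
      rw [hK1 _ hP1, hK2 _ hP2]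
    simp only [Set.mem_ofPred_eq]
    rw [e.differentiableAt_iff]
    have hNr : (N : ℝ) = m + n := by exact_mod_cast hN
    constructor
    · intro hnd
      by_contra hne
      apply hnd
      rcases lt_or_gt_of_ne hne with h | h
      · rw [(max_diff_left (by fun_prop) (by fun_prop)
          (by simp only; rw [hNr]; linarith)).differentiableAt_iff]
        fun_prop
      · rw [(max_diff_right (by fun_prop) (by fun_prop)
          (by simp only; rw [hNr]; linarith)).differentiableAt_iff]
        fun_prop
    · intro hY hd
      have hd2 : DifferentiableAt ℝ (fun y : ℝ => max (a N + (N : ℝ) * X) (b m + (m : ℝ) * X + y)) Y :=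
        DifferentiableAt.comp (f := fun y : ℝ => (X, y)) Y hd (by fun_prop)
      have h3 := hd2.sub (differentiableAt_const (b m + (m : ℝ) * X))
      refine not_diff_max Y (h3.congr_of_eventuallyEq (Filter.Eventually.of_forall fun y => ?_))
      have : a N + (N : ℝ) * X = b m + (m : ℝ) * X + Y := by rw [hNr, hY]; ring
      simp only [Pi.sub_apply]
      rw [this, max_add_add_left, max_comm]
      ring
  · obtain ⟨K, hK⟩ := TP_bot m b
    refine ⟨max (-K) (max 0 (TP N a 0 - b 0)), fun X hX Y hY => ?_⟩
    have h0 := le_max_left (-K) (max 0 (TP N a 0 - b 0))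
    have h1 := (le_max_left 0 (TP N a 0 - b 0)).trans (le_max_right (-K) _)
    have h2 := (le_max_right 0 (TP N a 0 - b 0)).trans (le_max_right (-K) _)
    have h3 : TP N a X ≤ TP N a 0 := TP_mono _ _ (by linarith)
    have hXK : X < K := by linarith
    have h4 := hK X hXK
    simp only [Set.mem_ofPred_eq]
    rw [up X Y (by linarith), ← TP_diff_iff hb, not_not]
    have : TP m b =ᶠ[nhds X] fun _ => b 0 := by
      filter_upwards [gt_mem_nhds hXK] with x hx
      exact hK x hx
    rw [this.differentiableAt_iff]
    fun_prop
  · intro X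
    exact ⟨TP N a X - TP m b X, fun Y hY => up X Y (by linarith)⟩

lemma MfunEven_eq (m : ℕ) (a b : ℕ → ℝ) :
    MfunEven (2 * (m + 1)) a b = fun P : ℝ × ℝ =>
      max (TP (3 * (m + 1)) (fun i => a (3 * (m + 1) - i)) P.1) (TP m b P.1 + P.2) := by
  funext P
  have h3 : 3 * (2 * (m + 1)) / 2 = 3 * (m + 1) := by omega
  have h1 : 2 * (m + 1) / 2 = m + 1 := by omega
  unfold MfunEven
  congr 1
  · simp only [TP, h3]
  · apply le_antisymm
    · refine Finset.sup'_le _ _ fun i hi => ?_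
      have : i ≤ m := by simp [h1] at hi; omega
      linarith [TP_ge m b P.1 this]
    · obtain ⟨i, hi, h⟩ := TP_exists m b P.1
      rw [h]
      exact Finset.le_sup' (fun i : ℕ => b i + (i : ℝ) * P.1 + P.2) (by simp [h1]; omega)

/-- Let `g` be even and let `C ⊂ ℝ²` be the tropical plane curve of degree
`3g/2` defined by `h ∈ 𝓜_g` satisfying the generic condition.  Then the
tropical hyperelliptic curve `Γ̄` of genus `g` intersects `C` with multiplicity
`3g²/2` at the point `P_∞ = (−∞ : 0 : −∞)` at infinity of `𝕋ℙ²`. -/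
theorem mult_at_Pinf_even (g : ℕ) (c : ℤ → ℝ) (hg : Even g) (hg2 : 2 ≤ g)
    (hc : Hyp g c) (a b : ℕ → ℝ) (hgen : GenCondEven g a b) :
    2 * multAtPinf (curveBar g c) {P | ¬ DifferentiableAt ℝ (MfunEven g a b) P}
      = 3 * (g : ℤ) ^ 2 := by
  obtain ⟨m, rfl⟩ : ∃ m, g = 2 * (m + 1) := by
    obtain ⟨r, rfl⟩ := hg
    exact ⟨r - 1, by omega⟩
  have hb : ∀ i, i + 2 ≤ m → b i + b (i + 2) < 2 * b (i + 1) := fun i hi => hgen.2.1 i (by omega)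
  have h1 := asym_curveBar _ c hc
  have h2 := asym_two (3 * (m + 1)) m (2 * (m + 1) + 1) (by ring)
    (fun i => a (3 * (m + 1) - i)) b hb
  rw [← MfunEven_eq] at h2
  have hcard : ((fun i => b i - b (i + 1)) '' Set.Iio m).ncard = m := by
    rw [Set.InjOn.ncard_image]
    · rw [← Finset.coe_range, Set.ncard_coe_finset, Finset.card_range]
    · intro i hi j hj hij
      simp only at hij
      rcases lt_trichotomy i j with h | h | h
      · exact absurd hij (gaps_mono hb h hj).ne
      · exact h
      · exact absurd hij (gaps_mono hb h hi).ne'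
  have key : ∀ v : ℤ × ℤ, (∑ᶠ w ∈ pinfDirs {P | ¬ DifferentiableAt ℝ (MfunEven (2 * (m + 1)) a b) P},
      ((rayOffsets (curveBar (2 * (m + 1)) c) v).ncard : ℤ) *
        ((rayOffsets {P | ¬ DifferentiableAt ℝ (MfunEven (2 * (m + 1)) a b) P} w).ncard : ℤ) *
      min ((v.2 - v.1) * w.2) (v.2 * (w.2 - w.1))) =
      ((rayOffsets (curveBar (2 * (m + 1)) c) v).ncard : ℤ) *
        (min ((v.2 - v.1) * ((2 * (m + 1) + 1 : ℕ) : ℤ)) (v.2 * (((2 * (m + 1) + 1 : ℕ) : ℤ) - 1))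
          + (m : ℤ) * min (v.2 - v.1) v.2) := by
    intro v
    have := h2.sum (by omega) (fun w => ((rayOffsets (curveBar (2 * (m + 1)) c) v).ncard : ℤ) *
      min ((v.2 - v.1) * w.2) (v.2 * (w.2 - w.1)))
    rw [hcard] at this
    simp only [mul_one, sub_zero] at this
    refine Eq.trans (finsum_mem_congr rfl fun w _ => ?_) (this.trans ?_) <;> ring
  unfold multAtPinf
  rw [finsum_mem_congr rfl fun v _ => key v, h1.sum (by omega) (fun v =>
    (min ((v.2 - v.1) * ((2 * (m + 1) + 1 : ℕ) : ℤ)) (v.2 * (((2 * (m + 1) + 1 : ℕ) : ℤ) - 1))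
          + (m : ℤ) * min (v.2 - v.1) v.2))]
  simp only [Set.ncard_empty]
  push_cast
  rw [mul_comm ((2 * ((m : ℤ) + 1) + 1) - 1) (2 * ((m : ℤ) + 1) + 1), min_self,
    min_eq_left (by linarith)]
  ring
end
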